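/- Let n ≥ 1, let a be a nonzero real number, and let u : ℝⁿ × (0,∞) → ℝ be a positive function which is C² in the space variable and C¹ in the time variable and solves the logarithmic heat equation ∂ₜu(x,t) = Δₓu(x,t) + a·u(x,t)·ln u(x,t) for all x ∈ ℝⁿ and t > 0. Then for every x ∈ ℝⁿ and t > 0 one has Δₓ(ln u(·,t))(x) + n·a/(2·(1 − e^{−a t})) ≥ 0. -/

import Mathlib

/-- The Laplacian of a function on Euclidean space: the sum of its second
partial derivatives (the trace of its second derivative). -/
noncomputable def laplacian {n : ℕ} (v : EuclideanSpace ℝ (Fin n) → ℝ)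
    (x : EuclideanSpace ℝ (Fin n)) : ℝ :=
  ∑ i : Fin n, fderiv ℝ (fun y => fderiv ℝ v y (EuclideanSpace.single i 1)) x
    (EuclideanSpace.single i 1)

namespace LogHeat

open Set Filter Topology Metric

/-- First partial derivative. -/
noncomputable def pd {n : ℕ} (v : EuclideanSpace ℝ (Fin n) → ℝ) (i : Fin n)
    (x : EuclideanSpace ℝ (Fin n)) : ℝ := fderiv ℝ v x (EuclideanSpace.single i 1)

/-- Second pure partial derivative. -/
noncomputable def pdd {n : ℕ} (v : EuclideanSpace ℝ (Fin n) → ℝ) (i : Fin n)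
    (x : EuclideanSpace ℝ (Fin n)) : ℝ := pd (pd v i) i x

lemma laplacian_eq {n : ℕ} (v : EuclideanSpace ℝ (Fin n) → ℝ) (x : EuclideanSpace ℝ (Fin n)) :
    laplacian v x = ∑ i, pdd v i x := rfl

/-- `g = e^{-at} log u` solves `g_t = Δ g + e^{at} |∇ g|²`. -/
structure Sol (n : ℕ) (a : ℝ) (g : EuclideanSpace ℝ (Fin n) → ℝ → ℝ) : Prop where
  space : ∀ t, 0 < t → ContDiff ℝ 2 (fun x => g x t)
  time : ∀ x, ContDiffOn ℝ 1 (g x) (Ioi 0)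
  eqn : ∀ x t, 0 < t → deriv (g x) t =
    ∑ i, pdd (fun y => g y t) i x + Real.exp (a * t) * ∑ i, (pd (fun y => g y t) i x) ^ 2

lemma Sol.hasDerivAt {n : ℕ} {a : ℝ} {g : EuclideanSpace ℝ (Fin n) → ℝ → ℝ} (h : Sol n a g)
    (x : EuclideanSpace ℝ (Fin n)) {t : ℝ} (ht : 0 < t) :
    HasDerivAt (g x) (deriv (g x) t) t :=
  (((h.time x).differentiableOn (by norm_num)).differentiableAt (Ioi_mem_nhds ht)).hasDerivAt

lemma line_deriv {n : ℕ} {v : EuclideanSpace ℝ (Fin n) → ℝ} (hv : Differentiable ℝ v)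
    (x : EuclideanSpace ℝ (Fin n)) (i : Fin n) (c r : ℝ) :
    HasDerivAt (fun r : ℝ => v (x + (c * r) • EuclideanSpace.single i (1 : ℝ)))
      (c * pd v i (x + (c * r) • EuclideanSpace.single i (1 : ℝ))) r := by
  have h1 : HasDerivAt (fun r : ℝ => x + (c * r) • EuclideanSpace.single i (1 : ℝ))
      (c • EuclideanSpace.single i (1 : ℝ)) r := by
    have := (((hasDerivAt_id r).const_mul c).smul_const
      (EuclideanSpace.single i (1 : ℝ) : EuclideanSpace ℝ (Fin n))).const_add x
    simpa using this
  have h2 := (hv (x + (c * r) • EuclideanSpace.single i (1 : ℝ))).hasFDerivAt.comp_hasDerivAt r h1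
  refine HasDerivAt.congr_deriv (f := fun r : ℝ => v (x + (c * r) • EuclideanSpace.single i (1 : ℝ))) h2 ?_
  rw [map_smul]; rfl

lemma pd_contDiff {n : ℕ} {v : EuclideanSpace ℝ (Fin n) → ℝ} (hv : ContDiff ℝ 2 v) (i : Fin n) :
    ContDiff ℝ 1 (pd v i) := by
  have : ContDiff ℝ 1 (fderiv ℝ v) := hv.fderiv_right (by norm_num)
  exact this.clm_apply contDiff_const

lemma line_deriv2 {n : ℕ} {v : EuclideanSpace ℝ (Fin n) → ℝ} (hv : ContDiff ℝ 2 v)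
    (x : EuclideanSpace ℝ (Fin n)) (i : Fin n) (c : ℝ) :
    HasDerivAt (fun r : ℝ => c * pd v i (x + (c * r) • EuclideanSpace.single i (1 : ℝ)))
      (c ^ 2 * pdd v i x) 0 := by
  have h := (line_deriv ((pd_contDiff hv i).differentiable (by norm_num)) x i c 0).const_mul c
  have e : c ^ 2 * pdd v i x =
    c * (c * pd (pd v i) i (x + (c * 0) • EuclideanSpace.single i (1 : ℝ))) := by
    simp [pdd]; ring
  rw [e]; exact h

lemma normsq_line {n : ℕ} (v : EuclideanSpace ℝ (Fin n)) (i : Fin n) (r : ℝ) :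
    ‖v + r • EuclideanSpace.single i (1 : ℝ)‖ ^ 2 = ‖v‖ ^ 2 + 2 * r * v i + r ^ 2 := by
  rw [norm_add_sq_real, inner_smul_right, norm_smul]
  simp [EuclideanSpace.inner_single_right]
  ring

lemma local_min_1d {φ φ' : ℝ → ℝ} {c : ℝ} (h1 : ∀ᶠ r in 𝓝 0, HasDerivAt φ (φ' r) r)
    (h2 : HasDerivAt φ' c 0) (h : IsLocalMin φ 0) : φ' 0 = 0 ∧ 0 ≤ c := by
  have hd : deriv φ =ᶠ[𝓝 0] φ' := h1.mono fun r hr => hr.deriv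
  have h0 : φ' 0 = 0 := by rw [← hd.eq_of_nhds]; exact h.deriv_eq_zero
  refine ⟨h0, ?_⟩
  by_contra hc
  push Not at hc
  have hdd : deriv (deriv φ) 0 = c := by rw [hd.deriv_eq]; exact h2.deriv
  have hmax : IsLocalMax φ 0 := isLocalMax_of_deriv_deriv_neg (by rw [hdd]; exact hc)
    h.deriv_eq_zero h1.self_of_nhds.continuousAt
  have hconst : φ =ᶠ[𝓝 0] fun _ => φ 0 := by
    filter_upwards [h, hmax] with r hr hr' using le_antisymm hr' hr
  have h3 : deriv φ =ᶠ[𝓝 0] fun _ => 0 := by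
    have := hconst.deriv
    simpa using this
  have : deriv (deriv φ) 0 = 0 := by rw [h3.deriv_eq]; simp
  linarith

lemma right_min_1d {φ : ℝ → ℝ} {c : ℝ} (h1 : HasDerivAt φ c 0)
    (h : ∀ᶠ r in 𝓝[>] (0 : ℝ), φ 0 ≤ φ r) : 0 ≤ c := by
  have ht := (hasDerivAt_iff_tendsto_slope.1 h1).mono_left
    (nhdsWithin_mono 0 (show Ioi (0:ℝ) ⊆ {0}ᶜ from fun x hx => ne_of_gt hx))
  refine ge_of_tendsto ht ?_
  filter_upwards [h, self_mem_nhdsWithin] with r hr hr0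
  rw [slope_def_field]
  have : (0 : ℝ) < r := hr0
  apply div_nonneg <;> linarith

end LogHeat

namespace LogHeat
open Set Filter Topology Metric

lemma alg1 {G L L0 D B Y τ : ℝ} (hL0 : 0 < L0) (hL : L0 ≤ L) (hD : 0 < D)
    (h2 : ∀ l : ℝ, 0 ≤ G + l ^ 2 * L + (1 - l) ^ 2 * D + τ * B)
    (h1 : G + L ≤ τ * Y) : L0 ^ 2 ≤ τ * (B + Y) * (D + L0) := by
  have hLp : 0 < L := by linarith
  have hs : 0 < D + L := by linarith
  have h3 := h2 (D / (D + L))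
  have e1 : (D / (D + L)) ^ 2 * L + (1 - D / (D + L)) ^ 2 * D = L - L ^ 2 / (D + L) := by
    field_simp; ring
  have h4 : L ^ 2 / (D + L) ≤ τ * (B + Y) := by nlinarith
  have h5 : L0 ^ 2 / (D + L0) ≤ L ^ 2 / (D + L) := by
    rw [div_le_div_iff₀ (by linarith) hs]
    nlinarith [mul_nonneg hD.le (sub_nonneg.2 hL), mul_pos hL0 hLp, mul_nonneg (mul_pos hL0 hLp).le (sub_nonneg.2 hL),
      mul_nonneg (mul_nonneg hD.le (sub_nonneg.2 hL)) (add_pos hL0 hLp).le]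
  have h6 : L0 ^ 2 / (D + L0) ≤ τ * (B + Y) := h5.trans h4
  rwa [div_le_iff₀ (by linarith)] at h6

/-- `S = ∑ Pᵢ pᵢ`, `Q = |p|²`. -/
lemma alg2 {n ζ ζ' ψ R Q ε σ σM cm c μ P2 S : ℝ} (hn : 0 ≤ n) (hζ : 0 < ζ) (hζ' : 0 ≤ ζ')
    (hψ : 0 < ψ) (hψ1 : ψ ≤ 1) (hR : 0 < R) (hQ0 : 0 ≤ Q) (hQ : Q ≤ R ^ 2) (hε : 0 < ε)
    (hσ : 0 ≤ σ) (hσM : σ ≤ σM) (hcm : 0 < cm) (hc : cm ≤ c) (hμ : μ ≤ 1 / 2)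
    (hP2 : 0 ≤ P2) (hS : S ^ 2 ≤ P2 * Q)
    (hcond : ζ' + (4 * n + 24 + 16 * σM ^ 2 / (cm * ε)) * ζ / R ^ 2 ≤ (1 - μ) * c) :
    (4 * n / (ζ * R ^ 2 * ψ ^ 3) + 24 * Q / (ζ * R ^ 4 * ψ ^ 4)) + ζ' / (ζ ^ 2 * ψ ^ 2)
      + 2 * σ * (4 * |S| / (ζ * R ^ 2 * ψ ^ 3)) ≤ (1 - μ) * c * (1 / (ζ * ψ ^ 2) + ε * P2) ^ 2 := by
  have hc0 : 0 < c := by linarith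
  -- multiply by ζ² ψ⁴
  have hSR : |S| ≤ Real.sqrt P2 * R := by
    refine abs_le_of_sq_le_sq ?_ (by positivity)
    rw [mul_pow, Real.sq_sqrt hP2]
    exact hS.trans (mul_le_mul_of_nonneg_left hQ hP2)
  set w := Real.sqrt P2 with hw
  have hw0 : 0 ≤ w := Real.sqrt_nonneg _
  have hww : w ^ 2 = P2 := Real.sq_sqrt hP2
  have t1 : 4 * n / (ζ * R ^ 2 * ψ ^ 3) ≤ (4 * n * ζ / R ^ 2) / (ζ ^ 2 * ψ ^ 4) := by
    have : 4 * n / (ζ * R ^ 2 * ψ ^ 3) = (4 * n * ζ / R ^ 2) / (ζ ^ 2 * ψ ^ 4) * ψ := by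
      field_simp
    rw [this]
    exact mul_le_of_le_one_right (by positivity) hψ1
  have t2 : 24 * Q / (ζ * R ^ 4 * ψ ^ 4) ≤ (24 * ζ / R ^ 2) / (ζ ^ 2 * ψ ^ 4) := by
    have : 24 * Q / (ζ * R ^ 4 * ψ ^ 4) = (24 * ζ / R ^ 2) / (ζ ^ 2 * ψ ^ 4) * (Q / R ^ 2) := by
      field_simp
    rw [this]
    refine mul_le_of_le_one_right (by positivity) ?_
    rw [div_le_one (by positivity)]; exact hQ
  have t3 : ζ' / (ζ ^ 2 * ψ ^ 2) ≤ ζ' / (ζ ^ 2 * ψ ^ 4) := by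
    have : ζ' / (ζ ^ 2 * ψ ^ 2) = ζ' / (ζ ^ 2 * ψ ^ 4) * ψ ^ 2 := by field_simp
    rw [this]
    exact mul_le_of_le_one_right (by positivity) (pow_le_one₀ hψ.le hψ1)
  have t4 : 2 * σ * (4 * |S| / (ζ * R ^ 2 * ψ ^ 3)) ≤
      (c * ε * P2 * ζ * ψ ^ 2 + 16 * σM ^ 2 / (cm * ε) * ζ / R ^ 2) / (ζ ^ 2 * ψ ^ 4) := by
    have e1 : 2 * σ * (4 * |S| / (ζ * R ^ 2 * ψ ^ 3)) =
      (8 * σ * |S| * ζ * ψ / R ^ 2) / (ζ ^ 2 * ψ ^ 4) := by field_simp; ring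
    rw [e1]
    apply div_le_div_of_nonneg_right _ (by positivity)
    have e2 : 8 * σ * |S| * ζ * ψ / R ^ 2 ≤ 8 * σM * w * ζ * ψ / R := by
      have : 8 * σM * w * ζ * ψ / R = 8 * σM * (w * R) * ζ * ψ / R ^ 2 := by field_simp
      rw [this]
      have : 0 ≤ σM := hσ.trans hσM
      gcongr
    have e3 : 16 * σM ^ 2 / (c * ε) * ζ / R ^ 2 ≤ 16 * σM ^ 2 / (cm * ε) * ζ / R ^ 2 := by
      gcongr
    have e4 : 8 * σM * w * ζ * ψ / R ≤ c * ε * P2 * ζ * ψ ^ 2 + 16 * σM ^ 2 / (c * ε) * ζ / R ^ 2 := by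
      rw [← hww]
      have : c * ε * w ^ 2 * ζ * ψ ^ 2 + 16 * σM ^ 2 / (c * ε) * ζ / R ^ 2 - 8 * σM * w * ζ * ψ / R
        = ζ * c * ε * (w * ψ - 4 * σM / (c * ε * R)) ^ 2 := by field_simp; ring
      have h0 : 0 ≤ ζ * c * ε * (w * ψ - 4 * σM / (c * ε * R)) ^ 2 := by positivity
      linarith
    linarith
  have t5 : ((1 - μ) * c + c * ε * P2 * ζ * ψ ^ 2) / (ζ ^ 2 * ψ ^ 4) ≤
      (1 - μ) * c * (1 / (ζ * ψ ^ 2) + ε * P2) ^ 2 := by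
    have : (1 - μ) * c * (1 / (ζ * ψ ^ 2) + ε * P2) ^ 2 =
      (1 - μ) * c * (1 + ε * P2 * ζ * ψ ^ 2) ^ 2 / (ζ ^ 2 * ψ ^ 4) := by field_simp
    rw [this]
    apply div_le_div_of_nonneg_right _ (by positivity)
    have hq : 0 ≤ ε * P2 * ζ * ψ ^ 2 := by positivity
    set q := ε * P2 * ζ * ψ ^ 2
    have : c * ε * P2 * ζ * ψ ^ 2 = c * q := by ring
    rw [this]
    have h7 : 0 ≤ c * q * (1 / 2 - μ) := mul_nonneg (by positivity) (by linarith)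
    have h8 : 0 ≤ c * q ^ 2 * (1 - μ) := mul_nonneg (by positivity) (by linarith)
    nlinarith
  calc _ ≤ (4 * n * ζ / R ^ 2) / (ζ ^ 2 * ψ ^ 4) + (24 * ζ / R ^ 2) / (ζ ^ 2 * ψ ^ 4) +
        ζ' / (ζ ^ 2 * ψ ^ 4) +
        (c * ε * P2 * ζ * ψ ^ 2 + 16 * σM ^ 2 / (cm * ε) * ζ / R ^ 2) / (ζ ^ 2 * ψ ^ 4) := by
        linarith
    _ = (ζ' + (4 * n + 24 + 16 * σM ^ 2 / (cm * ε)) * ζ / R ^ 2 + c * ε * P2 * ζ * ψ ^ 2)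
        / (ζ ^ 2 * ψ ^ 4) := by ring
    _ ≤ ((1 - μ) * c + c * ε * P2 * ζ * ψ ^ 2) / (ζ ^ 2 * ψ ^ 4) := by
        apply div_le_div_of_nonneg_right _ (by positivity)
        linarith
    _ ≤ _ := t5

lemma bump_deriv {Q p R : ℝ} (hψ : 0 < 1 - Q / R ^ 2) :
    (∀ᶠ r in 𝓝 (0 : ℝ), HasDerivAt (fun r : ℝ => ((1 - (Q + 2 * r * p + r ^ 2) / R ^ 2) ^ 2)⁻¹)
      (4 * (p + r) / (R ^ 2 * (1 - (Q + 2 * r * p + r ^ 2) / R ^ 2) ^ 3)) r) ∧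
    HasDerivAt (fun r : ℝ => 4 * (p + r) / (R ^ 2 * (1 - (Q + 2 * r * p + r ^ 2) / R ^ 2) ^ 3))
      (4 / (R ^ 2 * (1 - Q / R ^ 2) ^ 3) + 24 * p ^ 2 / (R ^ 4 * (1 - Q / R ^ 2) ^ 4)) 0 := by
  by_cases hR : R = 0
  · subst hR; simp [hasDerivAt_const]
  have hd : ∀ r, HasDerivAt (fun r : ℝ => 1 - (Q + 2 * r * p + r ^ 2) / R ^ 2)
      (-(2 * p + 2 * r) / R ^ 2) r := by
    intro r
    have h := ((((((hasDerivAt_id r).const_mul 2).mul_const p).const_add Q).add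
      ((hasDerivAt_id r).pow 2)).div_const (R ^ 2)).const_sub 1
    refine (h.congr_deriv ?_)
    simp; ring
  have hc : ContinuousAt (fun r : ℝ => 1 - (Q + 2 * r * p + r ^ 2) / R ^ 2) 0 := (hd 0).continuousAt
  constructor
  · have : ∀ᶠ r in 𝓝 (0 : ℝ), 0 < 1 - (Q + 2 * r * p + r ^ 2) / R ^ 2 := by
      apply hc.eventually_const_lt
      simpa using hψ
    filter_upwards [this] with r hr
    have h := ((hd r).pow 2).inv (pow_ne_zero 2 hr.ne')
    refine (h.congr_deriv ?_)
    simp only [Pi.pow_apply]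
    generalize 1 - (Q + 2 * r * p + r ^ 2) / R ^ 2 = w at hr
    field_simp
    norm_num
    ring
  · have h := (((hasDerivAt_id (0:ℝ)).const_add p).const_mul 4).div
      (((hd 0).pow 3).const_mul (R ^ 2)) (by simp; exact ⟨hR, by simpa using hψ.ne'⟩)
    refine (h.congr_deriv ?_)
    simp
    generalize 1 - Q / R ^ 2 = w at hψ
    field_simp
    ring
end LogHeat

namespace LogHeat
open Set Filter Topology Metric

/-- Doubled functional. -/
noncomputable def Phi {n : ℕ} (g : EuclideanSpace ℝ (Fin n) → ℝ → ℝ) (A ζ : ℝ → ℝ)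
    (x0 : EuclideanSpace ℝ (Fin n)) (R : ℝ) (y : EuclideanSpace ℝ (Fin n)) (t : ℝ)
    (x : EuclideanSpace ℝ (Fin n)) (s : ℝ) : ℝ :=
  g y t - g x s + ‖y - x‖ ^ 2 / (4 * (A t - A s)) +
    (t - s) * ((ζ t)⁻¹ * ((1 - ‖y - x0‖ ^ 2 / R ^ 2) ^ 2)⁻¹)

/-- One-sided local minimality. -/
def LMin {n : ℕ} (F : EuclideanSpace ℝ (Fin n) → ℝ → EuclideanSpace ℝ (Fin n) → ℝ → ℝ)
    (y : EuclideanSpace ℝ (Fin n)) (t : ℝ) (x : EuclideanSpace ℝ (Fin n)) (s : ℝ) : Prop :=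
  ∃ ρ > 0, ∀ y' t' x' s', ‖y' - y‖ < ρ → ‖x' - x‖ < ρ → |t' - t| < ρ → |s' - s| < ρ →
    t' ≤ t → t' - s' ≤ t - s → F y t x s ≤ F y' t' x' s'

section tests
variable {n : ℕ} {a ε R : ℝ} {g : EuclideanSpace ℝ (Fin n) → ℝ → ℝ} {A ζ : ℝ → ℝ} {ζ' : ℝ}
  {x0 y x : EuclideanSpace ℝ (Fin n)} {t s : ℝ}

lemma test_space (hg : Sol n a g) (hs : 0 < s) (hst : s < t)
    (hψ : 0 < 1 - ‖y - x0‖ ^ 2 / R ^ 2)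
    (hmin : LMin (Phi g A ζ x0 R) y t x s) (i : Fin n) (l : ℝ) :
    (pd (fun z => g z t) i y - l * pd (fun z => g z s) i x
      + (1 - l) * (y i - x i) / (2 * (A t - A s))
      + (t - s) * ((ζ t)⁻¹ * (4 * (y i - x0 i) / (R ^ 2 * (1 - ‖y - x0‖ ^ 2 / R ^ 2) ^ 3))) = 0) ∧
    0 ≤ pdd (fun z => g z t) i y - l ^ 2 * pdd (fun z => g z s) i x
      + (1 - l) ^ 2 / (2 * (A t - A s))
      + (t - s) * ((ζ t)⁻¹ * (4 / (R ^ 2 * (1 - ‖y - x0‖ ^ 2 / R ^ 2) ^ 3)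
        + 24 * (y i - x0 i) ^ 2 / (R ^ 4 * (1 - ‖y - x0‖ ^ 2 / R ^ 2) ^ 4))) := by
  have ht : 0 < t := hs.trans hst
  obtain ⟨hb1, hb2⟩ := bump_deriv (p := y i - x0 i) hψ
  set I := A t - A s with hI
  set Q := ‖y - x0‖ ^ 2 with hQ
  set e : EuclideanSpace ℝ (Fin n) := EuclideanSpace.single i (1 : ℝ) with he
  have hgt := hg.space t ht
  have hgs := hg.space s hs
  let φ : ℝ → ℝ := fun r => g (y + (1 * r) • e) t - g (x + (l * r) • e) s
    + (‖y - x‖ ^ 2 + 2 * ((1 - l) * r) * (y i - x i) + ((1 - l) * r) ^ 2) / (4 * I)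
    + (t - s) * ((ζ t)⁻¹ * ((1 - (Q + 2 * r * (y i - x0 i) + r ^ 2) / R ^ 2) ^ 2)⁻¹)
  have hφ : ∀ r, φ r = Phi g A ζ x0 R (y + (1 * r) • e) t (x + (l * r) • e) s := by
    intro r
    have h1 : ‖(y + (1 * r) • e) - (x + (l * r) • e)‖ ^ 2 =
      ‖y - x‖ ^ 2 + 2 * ((1 - l) * r) * (y i - x i) + ((1 - l) * r) ^ 2 := by
      have := normsq_line (y - x) i ((1 - l) * r)
      rw [show (y + (1 * r) • e) - (x + (l * r) • e) = (y - x) + ((1 - l) * r) • e by module, this]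
      simp
    have h2 : ‖(y + (1 * r) • e) - x0‖ ^ 2 = Q + 2 * r * (y i - x0 i) + r ^ 2 := by
      have := normsq_line (y - x0) i r
      rw [show (y + (1 * r) • e) - x0 = (y - x0) + r • e by module, this]
      simp [hQ]
    simp only [φ, Phi, h1, h2, hI]
  let φ' : ℝ → ℝ := fun r => 1 * pd (fun z => g z t) i (y + (1 * r) • e)
    - l * pd (fun z => g z s) i (x + (l * r) • e)
    + (1 - l) * (y i - x i + (1 - l) * r) / (2 * I)
    + (t - s) * ((ζ t)⁻¹ * (4 * (y i - x0 i + r) /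
        (R ^ 2 * (1 - (Q + 2 * r * (y i - x0 i) + r ^ 2) / R ^ 2) ^ 3)))
  have hd1 : ∀ᶠ r in 𝓝 (0 : ℝ), HasDerivAt φ (φ' r) r := by
    filter_upwards [hb1] with r hr
    have k1 := line_deriv (hgt.differentiable (by norm_num)) y i 1 r
    have k2 := line_deriv (hgs.differentiable (by norm_num)) x i l r
    have k3 : HasDerivAt (fun r : ℝ => (‖y - x‖ ^ 2 + 2 * ((1 - l) * r) * (y i - x i)
        + ((1 - l) * r) ^ 2) / (4 * I)) ((1 - l) * (y i - x i + (1 - l) * r) / (2 * I)) r := by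
      have h0 : HasDerivAt (fun r : ℝ => (1 - l) * r) (1 - l) r := by
        simpa using (hasDerivAt_id r).const_mul (1 - l)
      have := ((((h0.const_mul 2).mul_const (y i - x i)).const_add (‖y - x‖ ^ 2)).add
        (h0.pow 2)).div_const (4 * I)
      refine this.congr_deriv ?_
      norm_num
      ring
    exact ((k1.sub k2).add k3).add ((hr.const_mul (ζ t)⁻¹).const_mul (t - s))
  have hd2 : HasDerivAt φ' (1 ^ 2 * pdd (fun z => g z t) i y - l ^ 2 * pdd (fun z => g z s) i x
      + (1 - l) ^ 2 / (2 * I)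
      + (t - s) * ((ζ t)⁻¹ * (4 / (R ^ 2 * (1 - Q / R ^ 2) ^ 3)
        + 24 * (y i - x0 i) ^ 2 / (R ^ 4 * (1 - Q / R ^ 2) ^ 4)))) 0 := by
    have k1 := line_deriv2 hgt y i 1
    have k2 := line_deriv2 hgs x i l
    have k3 : HasDerivAt (fun r : ℝ => (1 - l) * (y i - x i + (1 - l) * r) / (2 * I))
        ((1 - l) ^ 2 / (2 * I)) 0 := by
      have h0 : HasDerivAt (fun r : ℝ => (1 - l) * r) (1 - l) 0 := by
        simpa using (hasDerivAt_id (0:ℝ)).const_mul (1 - l)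
      have := ((h0.const_add (y i - x i)).const_mul (1 - l)).div_const (2 * I)
      refine this.congr_deriv ?_
      ring
    exact ((k1.sub k2).add k3).add ((hb2.const_mul (ζ t)⁻¹).const_mul (t - s))
  have hloc : IsLocalMin φ 0 := by
    obtain ⟨ρ, hρ, hm⟩ := hmin
    have c1 : ∀ᶠ r : ℝ in 𝓝 0, ‖(1 * r) • e‖ < ρ := by
      have : ContinuousAt (fun r : ℝ => ‖(1 * r) • e‖) 0 := by fun_prop
      apply this.eventually_lt_const; simpa using hρ
    have c2 : ∀ᶠ r : ℝ in 𝓝 0, ‖(l * r) • e‖ < ρ := by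
      have : ContinuousAt (fun r : ℝ => ‖(l * r) • e‖) 0 := by fun_prop
      apply this.eventually_lt_const; simpa using hρ
    filter_upwards [c1, c2] with r h1 h2
    rw [hφ, hφ]
    have := hm (y + (1 * r) • e) t (x + (l * r) • e) s (by simpa using h1) (by simpa using h2)
      (by simpa using hρ) (by simpa using hρ) le_rfl le_rfl
    simpa using this
  obtain ⟨r1, r2⟩ := local_min_1d hd1 hd2 hloc
  constructor
  · simpa [φ'] using r1
  · simpa using r2

lemma test_s (hg : Sol n a g) (hs : 0 < s) (hst : s < t) (hI : 0 < A t - A s)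
    (hA : HasDerivAt A (Real.exp (a * s) - ε) s)
    (hmin : LMin (Phi g A ζ x0 R) y t x s) :
    deriv (g x) s ≤ (Real.exp (a * s) - ε) * (‖y - x‖ ^ 2 / (4 * (A t - A s) ^ 2))
      - (ζ t)⁻¹ * ((1 - ‖y - x0‖ ^ 2 / R ^ 2) ^ 2)⁻¹ := by
  set b := (ζ t)⁻¹ * ((1 - ‖y - x0‖ ^ 2 / R ^ 2) ^ 2)⁻¹ with hb
  have hadd : HasDerivAt (fun r : ℝ => s + r) 1 0 := by
    simpa using (hasDerivAt_id (0:ℝ)).const_add s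
  have k1 : HasDerivAt (fun r => g x (s + r)) (deriv (g x) s) 0 := by
    have h := hg.hasDerivAt x hs
    have : HasDerivAt (g x) (deriv (g x) s) (s + 0) := by simpa using h
    exact (this.comp (0:ℝ) hadd).congr_deriv (mul_one _)
  have k2 : HasDerivAt (fun r => A (s + r)) (Real.exp (a * s) - ε) 0 := by
    have : HasDerivAt A (Real.exp (a * s) - ε) (s + 0) := by simpa using hA
    exact (this.comp (0:ℝ) hadd).congr_deriv (mul_one _)
  have k3 := ((k2.const_sub (A t)).const_mul 4)
  have k4 := (k3.inv (by simp; linarith)).const_mul (‖y - x‖ ^ 2)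
  have k5 := (hadd.const_sub t).mul_const b
  have k6 := ((k1.const_sub (g y t)).add k4).add k5
  have hm : ∀ᶠ r in 𝓝[>] (0 : ℝ), Phi g A ζ x0 R y t x s ≤ Phi g A ζ x0 R y t x (s + r) := by
    obtain ⟨ρ, hρ, hm⟩ := hmin
    filter_upwards [Ioo_mem_nhdsGT hρ] with r hr
    refine hm _ _ _ _ (by simpa using hρ) (by simpa using hρ) (by simpa using hρ) ?_ le_rfl ?_
    · rw [add_sub_cancel_left, abs_of_pos hr.1]; exact hr.2
    · linarith [hr.1]
  have := right_min_1d k6 (by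
    filter_upwards [hm] with r hr
    simp only [Phi] at hr
    simpa [div_eq_mul_inv, hb] using hr)
  simp only [add_zero] at this
  have e : ‖y - x‖ ^ 2 * (-(4 * -(Real.exp (a * s) - ε)) / (4 * (A t - A s)) ^ 2) =
    (Real.exp (a * s) - ε) * (‖y - x‖ ^ 2 / (4 * (A t - A s) ^ 2)) := by field_simp
  rw [e] at this
  linarith

lemma test_ts (hg : Sol n a g) (hs : 0 < s) (hst : s < t) (hI : 0 < A t - A s)
    (hAs : HasDerivAt A (Real.exp (a * s) - ε) s) (hAt : HasDerivAt A (Real.exp (a * t) - ε) t)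
    (hζ : 0 < ζ t) (hζ' : HasDerivAt ζ ζ' t)
    (hmin : LMin (Phi g A ζ x0 R) y t x s) :
    0 ≤ - deriv (g y) t + deriv (g x) s
      + (‖y - x‖ ^ 2 / (4 * (A t - A s) ^ 2)) * (Real.exp (a * t) - Real.exp (a * s))
      + (t - s) * (ζ' / (ζ t ^ 2 * (1 - ‖y - x0‖ ^ 2 / R ^ 2) ^ 2)) := by
  set b := ((1 - ‖y - x0‖ ^ 2 / R ^ 2) ^ 2)⁻¹ with hb
  have hsub : ∀ t : ℝ, HasDerivAt (fun r : ℝ => t - r) (-1) 0 := by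
    intro t; simpa using (hasDerivAt_id (0:ℝ)).const_sub t
  have cmp : ∀ (f : ℝ → ℝ) (f' t : ℝ), HasDerivAt f f' t →
      HasDerivAt (fun r => f (t - r)) (-f') 0 := by
    intro f f' t h
    have : HasDerivAt f f' (t - 0) := by simpa using h
    exact (this.comp (0:ℝ) (hsub t)).congr_deriv (mul_neg_one _)
  have k1 := cmp _ _ _ (hg.hasDerivAt x hs)
  have k1' := cmp _ _ _ (hg.hasDerivAt y (hs.trans hst))
  have k2 := cmp _ _ _ hAs
  have k2' := cmp _ _ _ hAt
  have kz := ((cmp _ _ _ hζ').inv (by simpa using hζ.ne')).mul_const b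
  have k3 := ((k2'.sub k2).const_mul 4)
  have k4 := (k3.inv (by simp; linarith)).const_mul (‖y - x‖ ^ 2)
  have k6 := ((k1'.sub k1).add k4).add (kz.const_mul (t - s))
  have hm : ∀ᶠ r in 𝓝[>] (0 : ℝ), Phi g A ζ x0 R y t x s ≤
      Phi g A ζ x0 R y (t - r) x (s - r) := by
    obtain ⟨ρ, hρ, hm⟩ := hmin
    filter_upwards [Ioo_mem_nhdsGT hρ] with r hr
    refine hm _ _ _ _ (by simpa using hρ) (by simpa using hρ) ?_ ?_ (by linarith [hr.1]) ?_
    · rw [show t - r - t = -r by ring, abs_neg, abs_of_pos hr.1]; exact hr.2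
    · rw [show s - r - s = -r by ring, abs_neg, abs_of_pos hr.1]; exact hr.2
    · linarith [hr.1]
  have := right_min_1d k6 (by
    filter_upwards [hm] with r hr
    simp only [Phi] at hr
    simpa [div_eq_mul_inv, hb] using hr)
  simp only [sub_zero, Pi.sub_apply] at this
  have e : ‖y - x‖ ^ 2 * (-(4 * (-(Real.exp (a * t) - ε) - -(Real.exp (a * s) - ε)))
      / (4 * (A t - A s)) ^ 2) =
    (‖y - x‖ ^ 2 / (4 * (A t - A s) ^ 2)) * (Real.exp (a * t) - Real.exp (a * s)) := by
    field_simp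
    ring_nf
  rw [e] at this
  have e2 : - -ζ' / ζ t ^ 2 * b = ζ' / (ζ t ^ 2 * (1 - ‖y - x0‖ ^ 2 / R ^ 2) ^ 2) := by
    rw [hb, neg_neg, div_mul_eq_div_div, div_eq_mul_inv _ ((1 - ‖y - x0‖ ^ 2 / R ^ 2) ^ 2)]
  rw [e2] at this
  linarith
end tests
end LogHeat

namespace LogHeat
open Set Filter Topology Metric

lemma alg3 {μ q c L0 : ℝ} (hμ : 0 < μ) (hμ2 : μ ≤ 1 / 2) (hq : 0 ≤ q) (hqm : q < μ)
    (hw : 0 < c * L0 ^ 2) (h : c * L0 ^ 2 ≤ (1 - μ) * c * L0 ^ 2 * (1 + q)) : False := by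
  have h1 : (1 - μ) * (1 + q) < 1 := by nlinarith
  have h2 : (1 - μ) * c * L0 ^ 2 * (1 + q) = (c * L0 ^ 2) * ((1 - μ) * (1 + q)) := by ring
  rw [h2] at h
  exact absurd (mul_lt_of_lt_one_right hw h1) (not_lt.2 h)

set_option maxHeartbeats 2000000 in
lemma min_contra {n : ℕ} {a ε R αm σM μ δ : ℝ} {g : EuclideanSpace ℝ (Fin n) → ℝ → ℝ}
    {A ζ : ℝ → ℝ} {ζ' : ℝ} {x0 y x : EuclideanSpace ℝ (Fin n)} {t s : ℝ}
    (hn : 1 ≤ n) (hg : Sol n a g) (hs : 0 < s) (hst : s < t)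
    (hA : ∀ t, HasDerivAt A (Real.exp (a * t) - ε) t) (hε : 0 < ε) (hR : 0 < R)
    (hψ : 0 < 1 - ‖y - x0‖ ^ 2 / R ^ 2) (hζ : 0 < ζ t) (hζ' : HasDerivAt ζ ζ' t) (hζ'0 : 0 ≤ ζ')
    (hσM : Real.exp (a * t) ≤ σM) (hαm : 0 < αm) (hI1 : αm * (t - s) ≤ A t - A s)
    (hI2 : A t - A s ≤ σM * (t - s)) (hμ : 0 < μ) (hμ2 : μ ≤ 1 / 2)
    (hcond : ζ' + (4 * n + 24 + 16 * σM ^ 2 / ((2 * αm / n) * ε)) * ζ t / R ^ 2 ≤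
      (1 - μ) * (2 / n * ((A t - A s) / (t - s))))
    (hδ : 2 * σM / n * (δ * (1 + ε / αm)) ≤ μ)
    (hmin : LMin (Phi g A ζ x0 R) y t x s) (hneg : Phi g A ζ x0 R y t x s < 0)
    (hgd : -δ < g y t - g x s) : False := by
  have hτ : 0 < t - s := by linarith
  have hn0 : (0:ℝ) < n := by exact_mod_cast hn
  have hI : 0 < A t - A s := lt_of_lt_of_le (by positivity) hI1
  have T := test_space (x := x) (x0 := x0) (A := A) (ζ := ζ) (R := R) hg hs hst hψ hmin
  have T4 := test_s (y := y) (x := x) hg hs hst hI (hA s) hmin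
  have T5 := test_ts (y := y) (x := x) hg hs hst hI (hA s) (hA t) hζ hζ' hmin
  rw [hg.eqn x s hs] at T4
  rw [hg.eqn x s hs, hg.eqn y t (hs.trans hst)] at T5
  have hσ0 : 0 < Real.exp (a * t) := Real.exp_pos _
  unfold Phi at hneg
  have hψ1 : 1 - ‖y - x0‖ ^ 2 / R ^ 2 ≤ 1 := by
    have : 0 ≤ ‖y - x0‖ ^ 2 / R ^ 2 := by positivity
    linarith
  have hQ : ‖y - x0‖ ^ 2 ≤ R ^ 2 := by
    have : ‖y - x0‖ ^ 2 / R ^ 2 < 1 := by linarith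
    rw [div_lt_one (by positivity)] at this
    exact this.le
  have hQs : ‖y - x0‖ ^ 2 = ∑ i, (y i - x0 i) ^ 2 := by
    rw [EuclideanSpace.norm_sq_eq]; simp
  have hPs : ‖y - x‖ ^ 2 = ∑ i, (y i - x i) ^ 2 := by
    rw [EuclideanSpace.norm_sq_eq]; simp
  set I := A t - A s with hIdef
  set τ := t - s with hτdef
  set ψ := 1 - ‖y - x0‖ ^ 2 / R ^ 2 with hψdef
  set P2 := ‖y - x‖ ^ 2 / (4 * I ^ 2) with hP2def
  set S := ∑ i, ((y i - x i) / (2 * I)) * (y i - x0 i) with hSdef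
  have hP2s : P2 = ∑ i, ((y i - x i) / (2 * I)) ^ 2 := by
    rw [hP2def, hPs, Finset.sum_div]
    refine Finset.sum_congr rfl fun i _ => ?_
    field_simp; ring
  have hCS : S ^ 2 ≤ P2 * ‖y - x0‖ ^ 2 := by
    rw [hP2s, hQs]
    exact Finset.sum_mul_sq_le_sq_mul_sq _ _ _
  set κ := τ * ((ζ t)⁻¹ * (4 / (R ^ 2 * ψ ^ 3))) with hκ
  have hκ0 : 0 ≤ κ := by positivity
  have py : ∀ i, pd (fun z => g z t) i y = -((y i - x i) / (2 * I) + κ * (y i - x0 i)) := by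
    intro i
    have h := (T i 0).1
    have e : τ * ((ζ t)⁻¹ * (4 * (y i - x0 i) / (R ^ 2 * ψ ^ 3))) = κ * (y i - x0 i) := by
      rw [hκ]; ring
    rw [e] at h
    have e2 : (1 - 0) * (y i - x i) / (2 * I) = (y i - x i) / (2 * I) := by ring
    rw [e2] at h
    linarith
  have px : ∀ i, pd (fun z => g z s) i x = -((y i - x i) / (2 * I)) := by
    intro i
    have h := (T i 1).1
    have e : τ * ((ζ t)⁻¹ * (4 * (y i - x0 i) / (R ^ 2 * ψ ^ 3))) = κ * (y i - x0 i) := by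
      rw [hκ]; ring
    rw [e, py i] at h
    have e2 : (1 - 1) * (y i - x i) / (2 * I) = 0 := by ring
    rw [e2] at h
    linarith
  have sx : ∑ i, (pd (fun z => g z s) i x) ^ 2 = P2 := by
    rw [hP2s]; exact Finset.sum_congr rfl fun i _ => by rw [px i]; ring
  have sy : ∑ i, (pd (fun z => g z t) i y) ^ 2 = P2 + 2 * κ * S + κ ^ 2 * ‖y - x0‖ ^ 2 := by
    rw [hP2s, hSdef, hQs, Finset.mul_sum, Finset.mul_sum, ← Finset.sum_add_distrib,
      ← Finset.sum_add_distrib]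
    exact Finset.sum_congr rfl fun i _ => by rw [py i]; ring
  rw [sx] at T4
  rw [sx, sy] at T5
  set G := ∑ i, pdd (fun z => g z t) i y with hG
  set H := ∑ i, pdd (fun z => g z s) i x with hH
  set b := (ζ t)⁻¹ * (ψ ^ 2)⁻¹ with hb
  have hb' : b = 1 / (ζ t * ψ ^ 2) := by rw [hb]; field_simp
  have hb0 : 0 < b := by positivity
  set B := 4 * n / (ζ t * R ^ 2 * ψ ^ 3) + 24 * ‖y - x0‖ ^ 2 / (ζ t * R ^ 4 * ψ ^ 4) with hB
  have T3 : ∀ l : ℝ, 0 ≤ G + l ^ 2 * (-H) + (1 - l) ^ 2 * (n / (2 * I)) + τ * B := by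
    intro l
    have h := Finset.sum_nonneg (s := Finset.univ) fun i _ => (T i l).2
    rw [Finset.sum_add_distrib, Finset.sum_add_distrib, Finset.sum_sub_distrib, ← Finset.mul_sum,
      ← Finset.mul_sum, ← Finset.mul_sum, Finset.sum_add_distrib, ← Finset.sum_div,
      ← Finset.sum_div, ← Finset.sum_div,
      ← Finset.mul_sum, ← hQs, ← hG, ← hH] at h
    simp only [Finset.sum_const, Finset.card_univ, Fintype.card_fin, nsmul_eq_mul] at h
    have e : G - l ^ 2 * H + n * (1 - l) ^ 2 / (2 * I) + τ * ((ζ t)⁻¹ * (n * 4 / (R ^ 2 * ψ ^ 3)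
        + 24 * ‖y - x0‖ ^ 2 / (R ^ 4 * ψ ^ 4))) =
      G + l ^ 2 * (-H) + (1 - l) ^ 2 * (n / (2 * I)) + τ * B := by
      rw [hB]; field_simp; ring
    rw [e] at h
    exact h
  have hP20 : 0 ≤ P2 := by positivity
  have hL : b + ε * P2 ≤ -H := by linarith
  have hL0 : 0 < b + ε * P2 := by positivity
  set Y := ζ' / (ζ t ^ 2 * ψ ^ 2) + 2 * Real.exp (a * t) * (4 * |S| / (ζ t * R ^ 2 * ψ ^ 3)) with hY
  have hGL : G + -H ≤ τ * Y := by
    have e : τ * Y = τ * (ζ' / (ζ t ^ 2 * ψ ^ 2)) + 2 * Real.exp (a * t) * κ * |S| := by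
      rw [hY, hκ]; field_simp
    rw [e]
    have e3 : -(Real.exp (a * t) * (2 * κ * S)) ≤ 2 * Real.exp (a * t) * κ * |S| := by
      have := neg_abs_le S
      have h0 : 0 ≤ 2 * Real.exp (a * t) * κ := by positivity
      nlinarith
    have e4 : 0 ≤ Real.exp (a * t) * (κ ^ 2 * ‖y - x0‖ ^ 2) := by positivity
    linarith
  have main := alg1 hL0 hL (by positivity : 0 < (n : ℝ) / (2 * I)) T3 hGL
  have hcc : 2 * αm / n ≤ 2 / n * (I / τ) := by
    rw [show 2 * αm / (n:ℝ) = 2 / n * αm by ring]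
    have : αm ≤ I / τ := by rwa [le_div_iff₀ hτ]
    gcongr
  have bd := alg2 (n := n) (c := 2 / n * (I / τ)) (S := S) (P2 := P2) hn0.le hζ hζ'0 hψ hψ1 hR (by positivity) hQ hε hσ0.le
    hσM (by positivity : 0 < 2 * αm / (n:ℝ)) hcc hμ2 hP20 hCS hcond
  rw [← hB, ← hb'] at bd
  have bd' : B + Y ≤ (1 - μ) * (2 / n * (I / τ)) * (b + ε * P2) ^ 2 := by
    rw [hY]; linarith
  set L0 := b + ε * P2 with hL0def
  -- smallness
  have sm1 : I * P2 + τ * b < δ := by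
    have : ‖y - x‖ ^ 2 / (4 * I) = I * P2 := by rw [hP2def]; field_simp
    rw [this] at hneg
    linarith
  have sm2 : τ * L0 < δ * (1 + ε / αm) := by
    have h1 : τ * (ε * P2) ≤ ε / αm * (I * P2) := by
      have : τ ≤ I / αm := by rw [le_div_iff₀ hαm]; linarith
      calc τ * (ε * P2) ≤ I / αm * (ε * P2) := by gcongr
        _ = _ := by ring
    have h2 : 0 ≤ I * P2 := by positivity
    have h3 : 0 < τ * b := by positivity
    have h4 : ε / αm * (I * P2) ≤ ε / αm * δ := by
      have : I * P2 ≤ δ := by linarith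
      gcongr
    rw [hL0def, mul_add]
    linarith
  have hδ0 : 0 < δ * (1 + ε / αm) := lt_trans (by positivity) sm2
  have hcM : 2 / n * (I / τ) ≤ 2 * σM / n := by
    rw [show 2 * σM / (n:ℝ) = 2 / n * σM by ring]
    have : I / τ ≤ σM := by rwa [div_le_iff₀ hτ]
    gcongr
  set c := 2 / n * (I / τ) with hc
  have hc0 : 0 < c := by positivity
  have sm3 : c * (τ * L0) < μ := by
    calc c * (τ * L0) < c * (δ * (1 + ε / αm)) := by gcongr
      _ ≤ 2 * σM / n * (δ * (1 + ε / αm)) := by gcongr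
      _ ≤ μ := hδ
  have hD : (n:ℝ) / (2 * I) = 1 / (c * τ) := by rw [hc]; field_simp
  rw [hD] at main
  have main2 : c * L0 ^ 2 ≤ (B + Y) * (1 + c * (τ * L0)) := by
    have : c * (τ * (B + Y) * (1 / (c * τ) + L0)) = (B + Y) * (1 + c * (τ * L0)) := by field_simp
    rw [← this]
    gcongr
  have h0 : 0 ≤ c * (τ * L0) := by positivity
  have main3 : c * L0 ^ 2 ≤ (1 - μ) * c * L0 ^ 2 * (1 + c * (τ * L0)) :=
    main2.trans (by gcongr)
  have hcl : 0 < c * L0 ^ 2 := by positivity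
  exact alg3 hμ hμ2 h0 sm3 hcl main3
end LogHeat

namespace LogHeat
open Set Filter Topology Metric

lemma A_mvt {a ε : ℝ} {A : ℝ → ℝ} (hA : ∀ t, HasDerivAt A (Real.exp (a * t) - ε) t) {s t : ℝ}
    (hst : s < t) : ∃ ξ ∈ Ioo s t, A t - A s = (Real.exp (a * ξ) - ε) * (t - s) := by
  obtain ⟨ξ, hξ, h⟩ := exists_hasDerivAt_eq_slope A _ hst
    (fun x _ => (hA x).continuousAt.continuousWithinAt) (fun x _ => hA x)
  refine ⟨ξ, hξ, ?_⟩
  have : t - s ≠ 0 := by linarith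
  rw [h]; field_simp

lemma modulus {n : ℕ} {g : EuclideanSpace ℝ (Fin n) → ℝ → ℝ} {A : ℝ → ℝ}
    {x0 : EuclideanSpace ℝ (Fin n)} {r t1 T σM η δ : ℝ} (hσM : 0 < σM)
    (hgc : ContinuousOn (fun p : EuclideanSpace ℝ (Fin n) × ℝ => g p.1 p.2)
      (closedBall x0 r ×ˢ Icc t1 T))
    (hI : ∀ s t, t1 ≤ s → s < t → t ≤ T → 0 < A t - A s ∧ A t - A s ≤ σM * (t - s))
    (hη : 0 < η) (hδ : 0 < δ) :
    ∃ h > 0, ∀ y t x s, ‖y - x0‖ ≤ r → ‖x - x0‖ ≤ r → t1 ≤ s → s < t → t ≤ T → t - s < h →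
      g y t - g x s + ‖y - x‖ ^ 2 / (4 * (A t - A s)) ≤ 0 →
      ‖y - x‖ < η ∧ |g y t - g x s| < δ := by
  have hK : IsCompact (closedBall x0 r ×ˢ Icc t1 T) :=
    (isCompact_closedBall x0 r).prod isCompact_Icc
  obtain ⟨η0, hη0, hu⟩ := Metric.uniformContinuousOn_iff.1
    (hK.uniformContinuousOn_of_continuous hgc) δ hδ
  obtain ⟨M, hM⟩ := hK.exists_bound_of_continuousOn hgc
  set η1 := min η η0
  have hη1 : 0 < η1 := lt_min hη hη0
  set M1 := max M 1
  have hM1 : 0 < M1 := lt_of_lt_of_le one_pos (le_max_right _ _)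
  refine ⟨min η1 (η1 ^ 2 / (12 * M1 * σM)), by positivity, ?_⟩
  intro y t x s hy hx hs hst htT hlt hle
  have my : (y, t) ∈ closedBall x0 r ×ˢ Icc t1 T :=
    ⟨by simpa [dist_eq_norm] using hy, by constructor <;> linarith⟩
  have mx : (x, s) ∈ closedBall x0 r ×ˢ Icc t1 T :=
    ⟨by simpa [dist_eq_norm] using hx, by constructor <;> linarith⟩
  have by1 := hM _ my
  have bx1 := hM _ mx
  simp only [Real.norm_eq_abs] at by1 bx1
  have by2 := abs_le.1 (by1.trans (le_max_left M 1))
  have bx2 := abs_le.1 (bx1.trans (le_max_left M 1))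
  obtain ⟨hI1, hI2⟩ := hI s t hs hst htT
  have hlt1 : t - s < η1 := lt_of_lt_of_le hlt (min_le_left _ _)
  have hlt2 : t - s < η1 ^ 2 / (12 * M1 * σM) := lt_of_lt_of_le hlt (min_le_right _ _)
  have hxy : ‖y - x‖ < η1 := by
    by_contra hcon
    push Not at hcon
    have h1 : ‖y - x‖ ^ 2 / (4 * (A t - A s)) ≤ 2 * M1 := by
      change -M1 ≤ _ ∧ _ ≤ M1 at by2
      change -M1 ≤ _ ∧ _ ≤ M1 at bx2
      linarith
    rw [div_le_iff₀ (by linarith)] at h1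
    have h2 : η1 ^ 2 ≤ ‖y - x‖ ^ 2 := by gcongr
    rw [lt_div_iff₀ (by positivity)] at hlt2
    have h3 : 2 * M1 * (4 * (A t - A s)) ≤ 2 * M1 * (4 * (σM * (t - s))) := by gcongr
    have h4 : 0 < (t - s) * (M1 * σM) := by
      have : 0 < t - s := by linarith
      positivity
    nlinarith
  refine ⟨lt_of_lt_of_le hxy (min_le_left _ _), ?_⟩
  have := hu _ my _ mx (by
    rw [Prod.dist_eq]
    apply max_lt
    · rw [dist_eq_norm]; exact lt_of_lt_of_le hxy (min_le_right _ _)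
    · rw [Real.dist_eq, abs_of_pos (by linarith)]; exact lt_of_lt_of_le hlt1 (min_le_right _ _))
  simpa [Real.dist_eq] using this

set_option maxHeartbeats 1000000 in
lemma local_est {n : ℕ} {a ε R αm σM μ t0 T h0 : ℝ} {g : EuclideanSpace ℝ (Fin n) → ℝ → ℝ}
    {A ζ ζ' : ℝ → ℝ} {x0 : EuclideanSpace ℝ (Fin n)}
    (hn : 1 ≤ n) (hg : Sol n a g)
    (hA : ∀ t, HasDerivAt A (Real.exp (a * t) - ε) t) (hε : 0 < ε) (hR : 0 < R)
    (hh0 : 0 < h0) (ht0 : 0 < t0 - h0)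
    (hgc : ContinuousOn (fun p : EuclideanSpace ℝ (Fin n) × ℝ => g p.1 p.2)
      (closedBall x0 (2 * R) ×ˢ Icc (t0 - h0) T))
    (hσM0 : 0 < σM) (hσM : ∀ ξ ∈ Icc (t0 - h0) T, Real.exp (a * ξ) ≤ σM)
    (hαm : 0 < αm) (hα : ∀ ξ ∈ Icc (t0 - h0) T, αm ≤ Real.exp (a * ξ) - ε)
    (hμ : 0 < μ) (hμ2 : μ ≤ 1 / 2)
    (hζc : ContinuousOn ζ (Icc t0 T)) (hζ0 : ζ t0 = 0) (hζp : ∀ t ∈ Ioc t0 T, 0 < ζ t)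
    (hζd : ∀ t ∈ Ioc t0 T, HasDerivAt ζ (ζ' t) t) (hζd0 : ∀ t ∈ Ioc t0 T, 0 ≤ ζ' t)
    (hcond : ∀ t ∈ Ioc t0 T, ∀ ξ ∈ Icc (t - h0) t,
      ζ' t + (4 * n + 24 + 16 * σM ^ 2 / ((2 * αm / n) * ε)) * ζ t / R ^ 2 ≤
      (1 - μ) * (2 / n * (Real.exp (a * ξ) - ε))) :
    ∃ h > 0, h ≤ h0 ∧ ∀ y t x s, ‖y - x0‖ < R → t0 < t → t ≤ T → ‖x - x0‖ ≤ 2 * R →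
      t - h ≤ s → s < t → 0 ≤ Phi g A ζ x0 R y t x s := by
  have hn0 : (0:ℝ) < n := by exact_mod_cast hn
  have hI : ∀ s t, t0 - h0 ≤ s → s < t → t ≤ T →
      αm * (t - s) ≤ A t - A s ∧ A t - A s ≤ σM * (t - s) := by
    intro s t hs hst ht
    obtain ⟨ξ, hξ, e⟩ := A_mvt hA hst
    have hm : ξ ∈ Icc (t0 - h0) T := ⟨by linarith [hξ.1], by linarith [hξ.2]⟩
    have := hα ξ hm
    have := hσM ξ hm
    rw [e]
    constructor
    · exact mul_le_mul_of_nonneg_right (by linarith) (by linarith)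
    · exact mul_le_mul_of_nonneg_right (by linarith) (by linarith)
  have hI' : ∀ s t, t0 - h0 ≤ s → s < t → t ≤ T →
      0 < A t - A s ∧ A t - A s ≤ σM * (t - s) := by
    intro s t hs hst ht
    obtain ⟨h1, h2⟩ := hI s t hs hst ht
    exact ⟨lt_of_lt_of_le (mul_pos hαm (by linarith)) h1, h2⟩
  set δ := μ / (2 * σM / n * (1 + ε / αm)) with hδdef
  have hδ : 0 < δ := by positivity
  obtain ⟨h1, hh1, hmod⟩ := modulus hσM0 hgc hI' hR hδ
  refine ⟨min h0 (h1 / 2), by positivity, min_le_left _ _, ?_⟩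
  set h := min h0 (h1 / 2) with hhdef
  have hhh0 : h ≤ h0 := min_le_left _ _
  have hhh1 : h ≤ h1 / 2 := min_le_right _ _
  intro yb tb xb sb hyb htb0 htbT hxb hsb hsbt
  by_contra hneg
  push Not at hneg
  set e := - Phi g A ζ x0 R yb tb xb sb with he
  have he0 : 0 < e := by linarith
  obtain ⟨τ0, hτ0, hmod2⟩ := modulus hσM0 hgc hI' hR he0
  let E := EuclideanSpace ℝ (Fin n)
  let K : Set (E × ℝ × E × ℝ) :=
    closedBall x0 R ×ˢ Icc t0 T ×ˢ closedBall x0 (2 * R) ×ˢ Icc (t0 - h0) T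
  have hK : IsCompact K := (isCompact_closedBall x0 R).prod
    (isCompact_Icc.prod ((isCompact_closedBall x0 (2 * R)).prod isCompact_Icc))
  let K1 : Set (E × ℝ × E × ℝ) := K ∩ {p | p.2.1 - h ≤ p.2.2.2 ∧ p.2.2.2 ≤ p.2.1 - τ0}
  have hK1 : IsCompact K1 := by
    apply hK.inter_right
    apply IsClosed.inter
    · exact isClosed_le (f := fun p : E × ℝ × E × ℝ => p.2.1 - h) (g := fun p => p.2.2.2)
        (by fun_prop) (by fun_prop)
    · exact isClosed_le (f := fun p : E × ℝ × E × ℝ => p.2.2.2) (g := fun p => p.2.1 - τ0)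
        (by fun_prop) (by fun_prop)
  let ω : E × ℝ × E × ℝ → ℝ := fun p => ζ p.2.1 * (1 - ‖p.1 - x0‖ ^ 2 / R ^ 2) ^ 2
  let Ψ : E × ℝ × E × ℝ → ℝ := fun p => g p.1 p.2.1 - g p.2.2.1 p.2.2.2
    + ‖p.1 - p.2.2.1‖ ^ 2 / (4 * (A p.2.1 - A p.2.2.2))
  have hPhi : ∀ p : E × ℝ × E × ℝ, Phi g A ζ x0 R p.1 p.2.1 p.2.2.1 p.2.2.2 =
      Ψ p + (p.2.1 - p.2.2.2) * (ω p)⁻¹ := by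
    intro p; simp only [Phi, Ψ, ω, mul_inv]
  have hωc : ContinuousOn ω K1 := by
    apply ContinuousOn.mul
    · exact hζc.comp (by fun_prop) (fun p hp => hp.1.2.1)
    · fun_prop
  have hAc : Continuous A := continuous_iff_continuousAt.2 fun t => (hA t).continuousAt
  have hΨc : ContinuousOn Ψ K1 := by
    apply ContinuousOn.add
    · apply ContinuousOn.sub
      · refine hgc.comp (f := fun p : E × ℝ × E × ℝ => (p.1, p.2.1)) (by fun_prop) ?_
        intro p hp
        refine ⟨closedBall_subset_closedBall (by linarith) hp.1.1, ?_, hp.1.2.1.2⟩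
        linarith [hp.1.2.1.1]
      · refine hgc.comp (f := fun p : E × ℝ × E × ℝ => (p.2.2.1, p.2.2.2)) (by fun_prop) ?_
        intro p hp
        exact ⟨hp.1.2.2.1, hp.1.2.2.2⟩
    · apply ContinuousOn.div (by fun_prop) (by fun_prop)
      intro p hp
      have := (hI' p.2.2.2 p.2.1 hp.1.2.2.2.1 (by linarith [hp.2.2]) hp.1.2.1.2).1
      positivity
  let F : E × ℝ × E × ℝ → ℝ := fun p => ω p * (Ψ p + e) + (p.2.1 - p.2.2.2)
  have hFc : ContinuousOn F K1 := (hωc.mul (hΨc.add continuousOn_const)).add (by fun_prop)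
  let C : Set (E × ℝ × E × ℝ) := K1 ∩ F ⁻¹' (Iic 0)
  have hC : IsCompact C := hK1.of_isClosed_subset
    (hFc.preimage_isClosed_of_isClosed hK1.isClosed isClosed_Iic) inter_subset_left
  have hψ : ∀ p ∈ K1, 0 ≤ 1 - ‖p.1 - x0‖ ^ 2 / R ^ 2 := by
    intro p hp
    have h1 : ‖p.1 - x0‖ ≤ R := by simpa [dist_eq_norm] using hp.1.1
    have : ‖p.1 - x0‖ ^ 2 / R ^ 2 ≤ 1 := by
      rw [div_le_one (by positivity)]; gcongr
    linarith
  have hωp : ∀ p ∈ C, 0 < ω p := by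
    intro p hp
    have hζ : 0 ≤ ζ p.2.1 := by
      rcases eq_or_lt_of_le hp.1.1.2.1.1 with h | h
      · rw [← h, hζ0]
      · exact (hζp _ ⟨h, hp.1.1.2.1.2⟩).le
    have h1 : 0 ≤ ω p := by positivity
    rcases eq_or_lt_of_le h1 with h2 | h2
    · exfalso
      have h3 : F p ≤ 0 := hp.2
      simp only [F, ← h2] at h3
      linarith [hp.1.2.2]
    · exact h2
  have hmem : ∀ p : E × ℝ × E × ℝ, ‖p.1 - x0‖ < R → t0 < p.2.1 → p.2.1 ≤ T →
      ‖p.2.2.1 - x0‖ ≤ 2 * R → p.2.1 - h ≤ p.2.2.2 → p.2.2.2 < p.2.1 →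
      Phi g A ζ x0 R p.1 p.2.1 p.2.2.1 p.2.2.2 ≤ -e → p ∈ C := by
    rintro ⟨y, t, x, s⟩ hy ht htT hx hs hst hΦ
    simp only at hy ht htT hx hs hst hΦ
    have hψ1 : 0 < 1 - ‖y - x0‖ ^ 2 / R ^ 2 := by
      have : ‖y - x0‖ ^ 2 / R ^ 2 < 1 := by
        rw [div_lt_one (by positivity)]; gcongr
      linarith
    have hζ1 := hζp t ⟨ht, htT⟩
    have hω1 : 0 < ω (y, t, x, s) := by simp only [ω]; positivity
    have hP := hPhi (y, t, x, s)
    simp only at hP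
    rw [hP] at hΦ
    have hq : 0 < (t - s) * (ω (y, t, x, s))⁻¹ := mul_pos (by linarith) (inv_pos.2 hω1)
    have hs0 : t0 - h0 ≤ s := by linarith
    have hτ : τ0 ≤ t - s := by
      by_contra hcon
      push Not at hcon
      have := (hmod2 y t x s (by linarith) hx hs0 hst htT hcon (by
        have : Ψ (y, t, x, s) ≤ 0 := by linarith
        simpa [Ψ] using this)).2
      have h5 := (abs_lt.1 this).1
      have h6 : 0 ≤ ‖y - x‖ ^ 2 / (4 * (A t - A s)) := by
        have := (hI' s t hs0 hst htT).1
        positivity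
      have h7 : Ψ (y, t, x, s) = g y t - g x s + ‖y - x‖ ^ 2 / (4 * (A t - A s)) := rfl
      linarith
    refine ⟨⟨⟨by simpa [dist_eq_norm] using hy.le, ⟨ht.le, htT⟩, by simpa [dist_eq_norm] using hx,
      hs0, by simp only; linarith⟩, hs, by simp only; linarith⟩, ?_⟩
    have h8 : Ψ (y, t, x, s) + e ≤ -((t - s) * (ω (y, t, x, s))⁻¹) := by linarith
    have h9 := mul_le_mul_of_nonneg_left h8 hω1.le
    have h10 : ω (y, t, x, s) * -((t - s) * (ω (y, t, x, s))⁻¹) = -(t - s) := by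
      field_simp
    rw [h10] at h9
    change ω (y, t, x, s) * (Ψ (y, t, x, s) + e) + (t - s) ≤ 0
    linarith
  have hne : C.Nonempty := ⟨(yb, tb, xb, sb), hmem (yb, tb, xb, sb) hyb htb0 htbT hxb hsb hsbt
    (by simp [he])⟩
  have hΦc : ContinuousOn (fun p : E × ℝ × E × ℝ => Ψ p + (p.2.1 - p.2.2.2) * (ω p)⁻¹) C := by
    refine (hΨc.mono inter_subset_left).add (ContinuousOn.mul (by fun_prop) ?_)
    exact (hωc.mono inter_subset_left).inv₀ fun p hp => (hωp p hp).ne'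
  obtain ⟨⟨y, t, x, s⟩, hpC, hpmin⟩ := hC.exists_isMinOn hne hΦc
  have hω1 := hωp _ hpC
  have hle : Phi g A ζ x0 R y t x s ≤ -e := by
    have hP := hPhi (y, t, x, s)
    simp only at hP
    rw [hP]
    have hF : ω (y, t, x, s) * (Ψ (y, t, x, s) + e) + (t - s) ≤ 0 := hpC.2
    have : (Ψ (y, t, x, s) + e) + (t - s) * (ω (y, t, x, s))⁻¹ ≤ 0 := by
      have := mul_nonpos_of_nonpos_of_nonneg hF (inv_pos.2 hω1).le
      have e1 : (ω (y, t, x, s) * (Ψ (y, t, x, s) + e) + (t - s)) * (ω (y, t, x, s))⁻¹ =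
        (Ψ (y, t, x, s) + e) + (t - s) * (ω (y, t, x, s))⁻¹ := by field_simp
      rwa [e1] at this
    linarith
  have hglob : ∀ y' t' x' s', ‖y' - x0‖ < R → t0 < t' → t' ≤ T → ‖x' - x0‖ ≤ 2 * R →
      t' - h ≤ s' → s' < t' → Phi g A ζ x0 R y t x s ≤ Phi g A ζ x0 R y' t' x' s' := by
    intro y' t' x' s' k1 k2 k3 k4 k5 k6
    by_cases hc : Phi g A ζ x0 R y' t' x' s' ≤ -e
    · have hm := hmem (y', t', x', s') k1 k2 k3 k4 k5 k6 hc
      have := hpmin hm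
      have hP := hPhi (y, t, x, s)
      have hP' := hPhi (y', t', x', s')
      simp only at hP hP'
      rw [hP, hP']
      exact this
    · linarith
  obtain ⟨⟨⟨hy, ⟨ht0', htT⟩, hx, hs0, -⟩, hsh, hsτ⟩, -⟩ := hpC
  simp only at hy ht0' htT hx hs0 hsh hsτ
  have hst : s < t := by linarith
  have htt : t0 < t := by
    rcases eq_or_lt_of_le ht0' with h | h
    · exfalso
      simp only [ω, ← h, hζ0, zero_mul] at hω1
      exact lt_irrefl _ hω1
    · exact h
  have hψ1 : 0 < 1 - ‖y - x0‖ ^ 2 / R ^ 2 := by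
    have h1 : ‖y - x0‖ ≤ R := by simpa [dist_eq_norm] using hy
    have h2 : 0 ≤ 1 - ‖y - x0‖ ^ 2 / R ^ 2 := by
      have : ‖y - x0‖ ^ 2 / R ^ 2 ≤ 1 := by
        rw [div_le_one (by positivity)]; gcongr
      linarith
    rcases eq_or_lt_of_le h2 with h3 | h3
    · exfalso
      simp only [ω, ← h3] at hω1
      simp at hω1
    · exact h3
  have hyR : ‖y - x0‖ < R := by
    have : ‖y - x0‖ ^ 2 / R ^ 2 < 1 := by linarith
    rw [div_lt_one (by positivity)] at this
    exact lt_of_pow_lt_pow_left₀ 2 hR.le this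
  have hx2 : ‖x - x0‖ ≤ 2 * R := by simpa [dist_eq_norm] using hx
  have hζ1 := hζp t ⟨htt, htT⟩
  have hΨ0 : g y t - g x s + ‖y - x‖ ^ 2 / (4 * (A t - A s)) ≤ 0 := by
    have : 0 < (t - s) * ((ζ t)⁻¹ * ((1 - ‖y - x0‖ ^ 2 / R ^ 2) ^ 2)⁻¹) :=
      mul_pos (by linarith) (by positivity)
    unfold Phi at hle
    linarith
  obtain ⟨hxy, hgd⟩ := hmod y t x s (by linarith) hx2 hs0 hst htT (by linarith) hΨ0
  have hxR : ‖x - x0‖ < 2 * R := by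
    calc ‖x - x0‖ = ‖(y - x0) - (y - x)‖ := by congr 1; abel
      _ ≤ ‖y - x0‖ + ‖y - x‖ := norm_sub_le _ _
      _ < 2 * R := by linarith
  have hmin : LMin (Phi g A ζ x0 R) y t x s := by
    refine ⟨min (min (R - ‖y - x0‖) (2 * R - ‖x - x0‖)) (min (t - t0) ((t - s) / 2)), ?_, ?_⟩
    · apply lt_min <;> apply lt_min <;> linarith
    · intro y' t' x' s' k1 k2 k3 k4 k5 k6
      have q1 := lt_of_lt_of_le k1 ((min_le_left _ _).trans (min_le_left _ _))
      have q2 := lt_of_lt_of_le k2 ((min_le_left _ _).trans (min_le_right _ _))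
      have q3 := lt_of_lt_of_le k3 ((min_le_right _ _).trans (min_le_left _ _))
      have q4 := lt_of_lt_of_le k4 ((min_le_right _ _).trans (min_le_right _ _))
      have q5 := lt_of_lt_of_le k3 ((min_le_right _ _).trans (min_le_right _ _))
      have n1 : ‖y' - x0‖ ≤ ‖y' - y‖ + ‖y - x0‖ := norm_sub_le_norm_sub_add_norm_sub _ _ _
      have n2 : ‖x' - x0‖ ≤ ‖x' - x‖ + ‖x - x0‖ := norm_sub_le_norm_sub_add_norm_sub _ _ _
      rw [abs_lt] at q3 q4 q5
      apply hglob <;> linarith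
  obtain ⟨hI1, hI2⟩ := hI s t hs0 hst htT
  refine min_contra hn hg (by linarith) hst hA hε hR hψ1 hζ1 (hζd t ⟨htt, htT⟩)
    (hζd0 t ⟨htt, htT⟩) (hσM t ⟨by linarith, htT⟩) hαm hI1 hI2 hμ hμ2 ?_ ?_ hmin (by linarith)
    (abs_lt.1 hgd).1
  · obtain ⟨ξ, hξ, e1⟩ := A_mvt hA hst
    have : (A t - A s) / (t - s) = Real.exp (a * ξ) - ε := by
      have : t - s ≠ 0 := by linarith
      rw [e1]; field_simp
    rw [this]
    exact hcond t ⟨htt, htT⟩ ξ ⟨by linarith [hξ.1], hξ.2.le⟩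
  · rw [hδdef]
    apply le_of_eq
    have : 0 < 1 + ε / αm := by positivity
    generalize 1 + ε / αm = w at this
    field_simp
end LogHeat

namespace LogHeat
open Set Filter Topology Metric

/-- Antiderivative of `e^{at} - ε`. -/
noncomputable def AA (a ε t : ℝ) : ℝ := (Real.exp (a * t) - 1) / a - ε * t

lemma AA_deriv {a : ℝ} (ha : a ≠ 0) (ε t : ℝ) :
    HasDerivAt (AA a ε) (Real.exp (a * t) - ε) t := by
  have h1 : HasDerivAt (fun t : ℝ => a * t) a t := by
    simpa using (hasDerivAt_id t).const_mul a
  have h2 := ((h1.exp.sub_const 1).div_const a).sub ((hasDerivAt_id t).const_mul ε)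
  refine h2.congr_deriv ?_
  field_simp

/-- Chaining of the short-time estimate. -/
lemma chain {n : ℕ} {g : EuclideanSpace ℝ (Fin n) → ℝ → ℝ} {A : ℝ → ℝ}
    {V : Set (EuclideanSpace ℝ (Fin n))} (hV : Convex ℝ V) {t1 T h B : ℝ} (hh : 0 < h)
    (hA : ∀ s t, t1 ≤ s → s < t → t ≤ T → 0 < A t - A s)
    (hshort : ∀ y ∈ V, ∀ x ∈ V, ∀ s t, t1 ≤ s → s < t → t ≤ T → t - s ≤ h →
      0 ≤ g y t - g x s + ‖y - x‖ ^ 2 / (4 * (A t - A s)) + B * (t - s)) (N : ℕ) :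
    ∀ y ∈ V, ∀ x ∈ V, ∀ s t, t1 ≤ s → s < t → t ≤ T → t - s ≤ (N + 1) * h →
      0 ≤ g y t - g x s + ‖y - x‖ ^ 2 / (4 * (A t - A s)) + B * (t - s) := by
  induction N with
  | zero =>
    intro y hy x hx s t h1 h2 h3 h4
    exact hshort y hy x hx s t h1 h2 h3 (by simpa using h4)
  | succ N ih =>
    intro y hy x hx s t h1 h2 h3 h4
    by_cases hc : t - s ≤ h
    · exact hshort y hy x hx s t h1 h2 h3 hc
    push Not at hc
    have hI1 := hA s (t - h) h1 (by linarith) (by linarith)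
    have hI2 := hA (t - h) t (by linarith) (by linarith) h3
    have hI : A t - A s = (A (t - h) - A s) + (A t - A (t - h)) := by ring
    rw [hI]
    have hIp : 0 < (A (t - h) - A s) + (A t - A (t - h)) := by positivity
    set I1 := A (t - h) - A s with hI1d
    set I2 := A t - A (t - h) with hI2d
    set z := x + (I1 / (I1 + I2)) • (y - x) with hz
    have hzV : z ∈ V := by
      have := hV hx hy (a := I2 / (I1 + I2)) (b := I1 / (I1 + I2)) (by positivity) (by positivity)
        (by field_simp; ring)
      convert this using 1
      have e : I2 / (I1 + I2) = 1 - I1 / (I1 + I2) := by field_simp; ring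
      rw [e, hz]; module
    have k1 := ih z hzV x hx s (t - h) h1 (by linarith) (by linarith) (by
      push_cast at h4 ⊢; linarith)
    have k2 := hshort y hy z hzV (t - h) t (by linarith) (by linarith) h3 (by linarith)
    rw [← hI1d] at k1
    rw [← hI2d] at k2
    have n1 : ‖z - x‖ = (I1 / (I1 + I2)) * ‖y - x‖ := by
      rw [hz, add_sub_cancel_left, norm_smul, Real.norm_of_nonneg (by positivity)]
    have n2 : ‖y - z‖ = (I2 / (I1 + I2)) * ‖y - x‖ := by
      have : y - z = (I2 / (I1 + I2)) • (y - x) := by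
        have e : I2 / (I1 + I2) = 1 - I1 / (I1 + I2) := by field_simp; ring
        rw [e, hz]; module
      rw [this, norm_smul, Real.norm_of_nonneg (by positivity)]
    rw [n1] at k1
    rw [n2] at k2
    have e : (I1 / (I1 + I2) * ‖y - x‖) ^ 2 / (4 * I1) + (I2 / (I1 + I2) * ‖y - x‖) ^ 2 / (4 * I2)
      = ‖y - x‖ ^ 2 / (4 * (I1 + I2)) := by field_simp
    rw [← e]
    nlinarith

lemma exp_bounds (a τm τM : ℝ) : ∃ m M : ℝ, 0 < m ∧ 0 < M ∧
    ∀ ξ ∈ Icc τm τM, m ≤ Real.exp (a * ξ) ∧ Real.exp (a * ξ) ≤ M := by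
  have hb : ∀ ξ ∈ Icc τm τM, |a * ξ| ≤ |a| * (|τm| + |τM|) := by
    intro ξ hξ
    rw [abs_mul]
    refine mul_le_mul_of_nonneg_left ?_ (abs_nonneg a)
    rw [abs_le]
    constructor
    · linarith [neg_abs_le τm, abs_nonneg τM, hξ.1]
    · linarith [le_abs_self τM, abs_nonneg τm, hξ.2]
  refine ⟨Real.exp (-(|a| * (|τm| + |τM|))), Real.exp (|a| * (|τm| + |τM|)), Real.exp_pos _,
    Real.exp_pos _, fun ξ hξ => ?_⟩
  have := abs_le.1 (hb ξ hξ)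
  exact ⟨Real.exp_le_exp.2 this.1, Real.exp_le_exp.2 this.2⟩

set_option maxHeartbeats 1000000 in
/-- Crude local Harnack inequality with constant depending only on the time interval. -/
lemma harnack {n : ℕ} {a : ℝ} (hn : 1 ≤ n) (ha : a ≠ 0) {g : EuclideanSpace ℝ (Fin n) → ℝ → ℝ}
    (hg : Sol n a g) {τm τM : ℝ} (hτm : 0 < τm) :
    ∃ C > 0, ∀ (x0 : EuclideanSpace ℝ (Fin n)) (R l T : ℝ), 0 < l → l ≤ R ^ 2 → 0 < R →
      τm ≤ T - 2 * l → T ≤ τM →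
      ContinuousOn (fun p : EuclideanSpace ℝ (Fin n) × ℝ => g p.1 p.2)
        (closedBall x0 (2 * R) ×ˢ Icc (T - 2 * l) T) →
      ∀ x y, ‖x - x0‖ ≤ R / 2 → ‖y - x0‖ ≤ R / 2 → ∀ s t, T - l / 2 ≤ s → s < t → t ≤ T →
        g x s - C * ‖y - x‖ ^ 2 / (t - s) - C * (t - s) / l ≤ g y t := by
  obtain ⟨m, M, hm, hM, hmM⟩ := exp_bounds a τm τM
  have hn0 : (0:ℝ) < n := by exact_mod_cast hn
  set C1 : ℝ := 4 * n + 24 + 16 * M ^ 2 / ((2 * (m / 2) / n) * (m / 2)) with hC1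
  have hC10 : 0 < C1 := by positivity
  set lam : ℝ := (m / 2) / n / (1 + C1) with hlam
  have hlam0 : 0 < lam := by positivity
  refine ⟨1 / (2 * m) + 4 / lam, by positivity, ?_⟩
  intro x0 R l T hl hlR hR hT1 hT2 hgc x y hx hy s t hs hst htT
  set A := AA a (m / 2) with hA
  have hsub : ∀ ξ, T - 2 * l ≤ ξ → ξ ≤ T → ξ ∈ Icc τm τM := fun ξ h1 h2 => ⟨by linarith, by linarith⟩
  obtain ⟨h, hh, hhl, hest⟩ := local_est (n := n) (a := a) (ε := m / 2) (R := R) (αm := m / 2)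
    (σM := M) (μ := 1 / 2) (t0 := T - l) (T := T) (h0 := l) (g := g) (A := A)
    (ζ := fun t => lam * (t - (T - l))) (ζ' := fun _ => lam) (x0 := x0) hn hg
    (fun t => AA_deriv ha _ t) (by positivity) hR hl (by linarith)
    (by rwa [show T - l - l = T - 2 * l by ring]) hM
    (fun ξ hξ => (hmM ξ (hsub ξ (by linarith [hξ.1]) hξ.2)).2) (by positivity)
    (fun ξ hξ => by
      have := (hmM ξ (hsub ξ (by linarith [hξ.1]) hξ.2)).1
      linarith) (by norm_num) le_rfl (by fun_prop) (by simp)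
    (fun t ht => mul_pos hlam0 (by linarith [ht.1]))
    (fun t ht => by
      have := ((hasDerivAt_id t).sub_const (T - l)).const_mul lam
      simpa using this) (fun t ht => hlam0.le) (by
      intro t ht ξ hξ
      have h1 := (hmM ξ (hsub ξ (by linarith [hξ.1, ht.1]) (by linarith [hξ.2, ht.2]))).1
      rw [← hC1]
      have h2 : C1 * (lam * (t - (T - l))) / R ^ 2 ≤ C1 * lam := by
        rw [div_le_iff₀ (by positivity)]
        have : t - (T - l) ≤ R ^ 2 := by linarith [ht.2]
        calc C1 * (lam * (t - (T - l))) ≤ C1 * (lam * R ^ 2) := by gcongr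
          _ = _ := by ring
      have h3 : lam + C1 * lam = (m / 2) / n := by rw [hlam]; field_simp
      have h4 : (m / 2) / n ≤ (1 - 1 / 2) * (2 / n * (Real.exp (a * ξ) - m / 2)) := by
        rw [show (1 - 1 / 2 : ℝ) * (2 / n * (Real.exp (a * ξ) - m / 2)) =
          (Real.exp (a * ξ) - m / 2) / n by ring]
        gcongr; linarith
      linarith)
  have hAI : ∀ s t, T - l / 2 ≤ s → s < t → t ≤ T → (m / 2) * (t - s) ≤ A t - A s := by
    intro s t hs hst ht
    obtain ⟨ξ, hξ, e⟩ := A_mvt (fun t => AA_deriv ha (m / 2) t) hst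
    rw [e]
    have h1 := (hmM ξ (hsub ξ (by linarith [hξ.1]) (by linarith [hξ.2]))).1
    exact mul_le_mul_of_nonneg_right (by linarith) (by linarith)
  have hAI' : ∀ s t, T - l / 2 ≤ s → s < t → t ≤ T → 0 < A t - A s := fun s t h1 h2 h3 =>
    lt_of_lt_of_le (mul_pos (by positivity) (by linarith)) (hAI s t h1 h2 h3)
  obtain ⟨N, hN⟩ := exists_nat_ge ((t - s) / h)
  have key := chain (n := n) (g := g) (A := A) (convex_closedBall x0 (R / 2)) (t1 := T - l / 2) (T := T) (h := h)
    (B := 4 / lam / l) hh hAI' (by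
      intro y hy x hx s t hs hst ht hts
      have hy' : ‖y - x0‖ ≤ R / 2 := by simpa [dist_eq_norm] using hy
      have hx' : ‖x - x0‖ ≤ R / 2 := by simpa [dist_eq_norm] using hx
      have := hest y t x s (by linarith) (by linarith) ht (by linarith) (by linarith) hst
      unfold Phi at this
      have hb : (lam * (t - (T - l)))⁻¹ * ((1 - ‖y - x0‖ ^ 2 / R ^ 2) ^ 2)⁻¹ ≤ 4 / lam / l := by
        have h1 : ‖y - x0‖ ^ 2 / R ^ 2 ≤ 1 / 4 := by
          rw [div_le_iff₀ (by positivity)]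
          have := norm_nonneg (y - x0)
          nlinarith
        have h2 : (9 / 16 : ℝ) ≤ (1 - ‖y - x0‖ ^ 2 / R ^ 2) ^ 2 := by nlinarith
        have h3 : lam * (l / 2) ≤ lam * (t - (T - l)) := by
          apply mul_le_mul_of_nonneg_left _ hlam0.le; linarith
        have h4 : lam * (l / 2) * (9 / 16) ≤ (lam * (t - (T - l))) * (1 - ‖y - x0‖ ^ 2 / R ^ 2) ^ 2 :=
          mul_le_mul h3 h2 (by norm_num) (le_trans (by positivity) h3)
        rw [← mul_inv]
        calc _ ≤ (lam * (l / 2) * (9 / 16))⁻¹ := inv_anti₀ (by positivity) h4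
          _ = (32 / 9) / lam / l := by field_simp; norm_num
          _ ≤ _ := by gcongr; norm_num
      have hb2 := mul_le_mul_of_nonneg_left hb (by linarith : 0 ≤ t - s)
      linarith) N y (by simpa [dist_eq_norm] using hy) x (by simpa [dist_eq_norm] using hx) s t hs hst htT (by
      rw [div_le_iff₀ hh] at hN
      nlinarith)
  have hts : 0 < t - s := by linarith
  have k1 : ‖y - x‖ ^ 2 / (4 * (A t - A s)) ≤ 1 / (2 * m) * ‖y - x‖ ^ 2 / (t - s) := by
    have := hAI s t hs hst htT
    calc ‖y - x‖ ^ 2 / (4 * (A t - A s)) ≤ ‖y - x‖ ^ 2 / (4 * ((m / 2) * (t - s))) := by gcongr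
      _ = _ := by field_simp; norm_num
  have k2 : 0 ≤ 4 / lam * ‖y - x‖ ^ 2 / (t - s) := by positivity
  have k3 : 0 ≤ 1 / (2 * m) * (t - s) / l := by positivity
  have e1 : (1 / (2 * m) + 4 / lam) * ‖y - x‖ ^ 2 / (t - s) =
    1 / (2 * m) * ‖y - x‖ ^ 2 / (t - s) + 4 / lam * ‖y - x‖ ^ 2 / (t - s) := by ring
  have e2 : (1 / (2 * m) + 4 / lam) * (t - s) / l =
    1 / (2 * m) * (t - s) / l + 4 / lam / l * (t - s) := by ring
  rw [e1, e2]
  linarith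
end LogHeat

namespace LogHeat
open Set Filter Topology Metric

lemma pd_comp {n : ℕ} {v : EuclideanSpace ℝ (Fin n) → ℝ} {f : ℝ → ℝ} {f' : ℝ}
    {x : EuclideanSpace ℝ (Fin n)} (hv : DifferentiableAt ℝ v x) (hf : HasDerivAt f f' (v x))
    (i : Fin n) : pd (fun y => f (v y)) i x = f' * pd v i x := by
  have h := hf.comp_hasFDerivAt x hv.hasFDerivAt
  have h2 : fderiv ℝ (fun y => f (v y)) x = f' • fderiv ℝ v x := h.fderiv
  simp [pd, h2]

lemma pd_mul {n : ℕ} {v w : EuclideanSpace ℝ (Fin n) → ℝ}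
    {x : EuclideanSpace ℝ (Fin n)} (hv : DifferentiableAt ℝ v x) (hw : DifferentiableAt ℝ w x)
    (i : Fin n) : pd (fun y => v y * w y) i x = v x * pd w i x + w x * pd v i x := by
  have h2 := fderiv_fun_mul hv hw
  simp [pd, h2]

lemma pdd_comp {n : ℕ} {v : EuclideanSpace ℝ (Fin n) → ℝ} {f f' : ℝ → ℝ} {f'' : ℝ}
    {x : EuclideanSpace ℝ (Fin n)} (hv : ContDiff ℝ 2 v)
    (hf : ∀ y, HasDerivAt f (f' (v y)) (v y)) (hf' : HasDerivAt f' f'' (v x)) (i : Fin n) :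
    pdd (fun y => f (v y)) i x = f' (v x) * pdd v i x + f'' * (pd v i x) ^ 2 := by
  have hd : Differentiable ℝ v := hv.differentiable (by norm_num)
  have h1 : pd (fun y => f (v y)) i = fun y => f' (v y) * pd v i y := by
    ext y; exact pd_comp (hd y) (hf y) i
  unfold pdd
  have h2 : DifferentiableAt ℝ (fun y => f' (v y)) x := hf'.differentiableAt.comp x (hd x)
  rw [h1, pd_mul (v := fun y => f' (v y)) (w := pd v i) h2
    (((pd_contDiff hv i).differentiable (by norm_num)) x), pd_comp (hd x) hf']
  ring

/-- Supersolution of the heat equation on a time interval. -/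
def Super {n : ℕ} (V : EuclideanSpace ℝ (Fin n) → ℝ → ℝ) (t1 t2 : ℝ) : Prop :=
  ∀ x t, t1 < t → t ≤ t2 → ContDiff ℝ 2 (fun y => V y t) ∧
    ∃ V', HasDerivAt (V x) V' t ∧ ∑ i, pdd (fun y => V y t) i x ≤ V'

lemma barrier_alg {n L K D ρ2 ρ0 : ℝ} (hρ0 : 0 < ρ0) (hρ : ρ0 ^ 2 ≤ ρ2) (hK0 : 0 < K)
    (hK : (2 * L + 8 + 4 * n) ^ 2 ≤ 32 * ρ0 ^ 2 * K) :
    -K * D ^ 2 + 2 * L * D ≤ 8 * (ρ2 - D) - 4 * n * D := by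
  have h1 : 0 ≤ 4 * K * (K * D ^ 2 - (2 * L + 8 + 4 * n) * D + 8 * ρ2) := by
    have : 4 * K * (K * D ^ 2 - (2 * L + 8 + 4 * n) * D + 8 * ρ2) =
      (2 * K * D - (2 * L + 8 + 4 * n)) ^ 2 + (32 * ρ2 * K - (2 * L + 8 + 4 * n) ^ 2) := by ring
    rw [this]
    have h2 : 32 * ρ0 ^ 2 * K ≤ 32 * ρ2 * K := by gcongr
    have := sq_nonneg (2 * K * D - (2 * L + 8 + 4 * n))
    linarith
  have h2 := nonneg_of_mul_nonneg_right h1 (by positivity)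
  linarith

set_option maxHeartbeats 1000000 in
lemma barrier {n : ℕ} {V : EuclideanSpace ℝ (Fin n) → ℝ → ℝ} {z : EuclideanSpace ℝ (Fin n)}
    {ρ0 L K κ t1 t2 ρM : ℝ} (hρ0 : 0 < ρ0) (hL : 0 ≤ L) (hK0 : 0 < K)
    (hK : (2 * L + 8 + 4 * n) ^ 2 ≤ 32 * ρ0 ^ 2 * K) (ht : t1 < t2) (hρM0 : 0 < ρM)
    (hρM : ρ0 ^ 2 + L * (t2 - t1) ≤ ρM ^ 2)
    (hc : ContinuousOn (fun p : EuclideanSpace ℝ (Fin n) × ℝ => V p.1 p.2)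
      (closedBall z ρM ×ˢ Icc t1 t2))
    (hV0 : ∀ x t, ‖x - z‖ ≤ ρM → t1 ≤ t → t ≤ t2 → 0 ≤ V x t) (hκ : 0 ≤ κ)
    (hini : ∀ x, ‖x - z‖ ≤ ρ0 → κ ≤ V x t1) (hsup : Super V t1 t2) (x : EuclideanSpace ℝ (Fin n))
    (hx : ‖x - z‖ ^ 2 ≤ ρ0 ^ 2 + L * (t2 - t1)) :
    κ / ρ0 ^ 4 * Real.exp (-K * (t2 - t1)) * (ρ0 ^ 2 + L * (t2 - t1) - ‖x - z‖ ^ 2) ^ 2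
      ≤ V x t2 := by
  by_contra hcon
  push Not at hcon
  set c := κ / ρ0 ^ 4 with hcdef
  have hc0 : 0 ≤ c := by positivity
  let D : EuclideanSpace ℝ (Fin n) → ℝ → ℝ := fun x t => ρ0 ^ 2 + L * (t - t1) - ‖x - z‖ ^ 2
  let w : EuclideanSpace ℝ (Fin n) → ℝ → ℝ := fun x t =>
    c * Real.exp (-K * (t - t1)) * (max (D x t) 0) ^ 2
  have hw2 : w x t2 = c * Real.exp (-K * (t2 - t1)) *
      (ρ0 ^ 2 + L * (t2 - t1) - ‖x - z‖ ^ 2) ^ 2 := by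
    simp only [w, D]; rw [max_eq_left (by linarith)]
  rw [← hw2] at hcon
  set η := (w x t2 - V x t2) / (2 * (t2 - t1)) with hη
  have hη0 : 0 < η := div_pos (by linarith) (by linarith)
  let q : EuclideanSpace ℝ (Fin n) × ℝ → ℝ := fun p => V p.1 p.2 - w p.1 p.2 + η * (p.2 - t1)
  have hqx : q (x, t2) < 0 := by
    have : η * (t2 - t1) = (w x t2 - V x t2) / 2 := by
      have : t2 - t1 ≠ 0 := by linarith
      rw [hη]; field_simp
    simp only [q]; rw [this]; linarith
  have hcomp : IsCompact (closedBall z ρM ×ˢ Icc t1 t2) :=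
    (isCompact_closedBall z ρM).prod isCompact_Icc
  have hqc : ContinuousOn q (closedBall z ρM ×ˢ Icc t1 t2) := by
    refine (hc.sub ?_).add (by fun_prop)
    apply Continuous.continuousOn
    simp only [w, D]
    fun_prop
  have hxz : ‖x - z‖ ≤ ρM := by
    have : ‖x - z‖ ^ 2 ≤ ρM ^ 2 := hx.trans hρM
    exact le_of_sq_le_sq this hρM0.le
  have hxm : (x, t2) ∈ closedBall z ρM ×ˢ Icc t1 t2 :=
    ⟨by simpa [dist_eq_norm] using hxz, ht.le, le_rfl⟩
  obtain ⟨⟨y, t⟩, ⟨hy, ht1', ht2⟩, hmin⟩ := hcomp.exists_isMinOn ⟨_, hxm⟩ hqc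
  have hqy : q (y, t) < 0 := lt_of_le_of_lt (hmin hxm) hqx
  simp only at hy ht1' ht2
  have hy' : ‖y - z‖ ≤ ρM := by simpa [dist_eq_norm] using hy
  have hVy := hV0 y t hy' ht1' ht2
  have hηt : 0 ≤ η * (t - t1) := mul_nonneg hη0.le (by linarith)
  have hwpos : 0 < w y t := by simp only [q] at hqy; linarith
  have hD : 0 < D y t := by
    by_contra hh
    push Not at hh
    simp only [w, max_eq_right hh] at hwpos
    simp at hwpos
  have ht1 : t1 < t := by
    rcases eq_or_lt_of_le ht1' with h | h
    · exfalso
      subst h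
      have hD1 : D y t1 = ρ0 ^ 2 - ‖y - z‖ ^ 2 := by simp [D]
      have hyr : ‖y - z‖ ≤ ρ0 := by
        apply le_of_sq_le_sq _ hρ0.le; linarith
      have h1 := hini y hyr
      have h2 : w y t1 ≤ κ := by
        have hm : max (D y t1) 0 = ρ0 ^ 2 - ‖y - z‖ ^ 2 := by rw [max_eq_left hD.le, hD1]
        simp only [w, hm]
        have h3 : (ρ0 ^ 2 - ‖y - z‖ ^ 2) ^ 2 ≤ (ρ0 ^ 2) ^ 2 := by
          have := sq_nonneg ‖y - z‖
          rw [hD1] at hD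
          gcongr; linarith
        have h4 : c * (ρ0 ^ 2) ^ 2 = κ := by rw [hcdef]; field_simp
        simp only [sub_self, mul_zero, Real.exp_zero, mul_one]
        calc c * (ρ0 ^ 2 - ‖y - z‖ ^ 2) ^ 2 ≤ c * (ρ0 ^ 2) ^ 2 := by gcongr
          _ = κ := h4
      simp only [q] at hqy
      linarith
    · exact h
  obtain ⟨hVs, V', hV', hle⟩ := hsup y t ht1 ht2
  set Ex := c * Real.exp (-K * (t - t1)) with hEx
  have hEx0 : 0 ≤ Ex := by positivity
  have hyM : ‖y - z‖ < ρM := by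
    have h1 : L * (t - t1) ≤ L * (t2 - t1) := by gcongr
    have h2 : 0 < ρ0 ^ 2 + L * (t - t1) - ‖y - z‖ ^ 2 := hD
    apply lt_of_pow_lt_pow_left₀ 2 hρM0.le
    linarith
  -- space tests
  have hsp : ∀ i, 0 ≤ pdd (fun y => V y t) i y - Ex * (8 * (y i - z i) ^ 2 - 4 * D y t) := by
    intro i
    set e : EuclideanSpace ℝ (Fin n) := EuclideanSpace.single i (1 : ℝ) with he
    set p := y i - z i with hp
    set D0 := D y t with hD0
    let φ : ℝ → ℝ := fun r => V (y + (1 * r) • e) t - Ex * (D0 - 2 * r * p - r ^ 2) ^ 2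
    let φ' : ℝ → ℝ := fun r => 1 * pd (fun y => V y t) i (y + (1 * r) • e)
      - Ex * (2 * (D0 - 2 * r * p - r ^ 2) * (-2 * p - 2 * r))
    have hpoly : ∀ r, HasDerivAt (fun r : ℝ => D0 - 2 * r * p - r ^ 2) (-2 * p - 2 * r) r := by
      intro r
      have := ((((hasDerivAt_id r).const_mul 2).mul_const p).const_sub D0).sub
        ((hasDerivAt_id r).pow 2)
      refine this.congr_deriv ?_
      simp
    have hd1 : ∀ᶠ r in 𝓝 (0:ℝ), HasDerivAt φ (φ' r) r := by
      refine Eventually.of_forall fun r => ?_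
      have k1 := line_deriv (hVs.differentiable (by norm_num)) y i 1 r
      have k2 := ((hpoly r).pow 2).const_mul Ex
      refine (k1.sub k2).congr_deriv ?_
      simp only [φ']
      norm_num
      rfl
    have hd2 : HasDerivAt φ' (1 ^ 2 * pdd (fun y => V y t) i y - Ex * (8 * p ^ 2 - 4 * D0)) 0 := by
      have k1 := line_deriv2 hVs y i 1
      have hlin : HasDerivAt (fun r : ℝ => -2 * p - 2 * r) (-2) 0 := by
        have := ((hasDerivAt_id (0:ℝ)).const_mul 2).const_sub (-2 * p)
        simpa using this
      have k2 := (((hpoly 0).const_mul 2).mul hlin).const_mul Ex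
      refine (k1.sub k2).congr_deriv ?_
      norm_num
      ring_nf
      simp
    have hloc : IsLocalMin φ 0 := by
      have c1 : ∀ᶠ r : ℝ in 𝓝 0, ‖y + (1 * r) • e - z‖ < ρM := by
        have : ContinuousAt (fun r : ℝ => ‖y + (1 * r) • e - z‖) 0 := by fun_prop
        apply this.eventually_lt_const; simpa using hyM
      have c2 : ∀ᶠ r : ℝ in 𝓝 0, 0 < D0 - 2 * r * p - r ^ 2 := by
        have : ContinuousAt (fun r : ℝ => D0 - 2 * r * p - r ^ 2) 0 := by fun_prop
        apply this.eventually_const_lt; simpa using hD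
      have hφq : ∀ r, 0 < D0 - 2 * r * p - r ^ 2 →
          φ r = q (y + (1 * r) • e, t) - η * (t - t1) := by
        intro r hr
        have h2 : ‖y + (1 * r) • e - z‖ ^ 2 = ‖y - z‖ ^ 2 + 2 * r * p + r ^ 2 := by
          have := normsq_line (y - z) i r
          rw [show (y + (1 * r) • e) - z = (y - z) + r • e by module, this]
          simp [hp]
        have h3 : D (y + (1 * r) • e) t = D0 - 2 * r * p - r ^ 2 := by
          simp only [D, h2, hD0]; ring
        simp only [φ, q, w, h3, max_eq_left hr.le, ← hEx]
        ring
      filter_upwards [c1, c2] with r h1 h2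
      rw [hφq r h2, hφq 0 (by simpa using hD)]
      have hm : (y + (1 * r) • e, t) ∈ closedBall z ρM ×ˢ Icc t1 t2 :=
        ⟨by simpa [dist_eq_norm] using h1.le, ht1', ht2⟩
      have := hmin hm
      have e0 : y + ((1:ℝ) * 0) • e = y := by simp
      rw [e0]
      exact sub_le_sub_right this _
    have := (local_min_1d hd1 hd2 hloc).2
    simpa using this
  have hsum := Finset.sum_nonneg (s := Finset.univ) fun i _ => hsp i
  rw [Finset.sum_sub_distrib, ← Finset.mul_sum, Finset.sum_sub_distrib, ← Finset.mul_sum] at hsum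
  have hQs : ‖y - z‖ ^ 2 = ∑ i, (y i - z i) ^ 2 := by
    rw [EuclideanSpace.norm_sq_eq]; simp
  rw [← hQs] at hsum
  simp only [Finset.sum_const, Finset.card_univ, Fintype.card_fin, nsmul_eq_mul] at hsum
  -- time test
  have htime : V' - Ex * (-K * D y t ^ 2 + 2 * L * D y t) + η ≤ 0 := by
    have hsub : HasDerivAt (fun r : ℝ => t - r) (-1) 0 := by
      simpa using (hasDerivAt_id (0:ℝ)).const_sub t
    have k1 : HasDerivAt (fun r => V y (t - r)) (-V') 0 := by
      have : HasDerivAt (V y) V' (t - 0) := by simpa using hV'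
      exact (this.comp (0:ℝ) hsub).congr_deriv (mul_neg_one _)
    have k2 : HasDerivAt (fun r : ℝ => c * Real.exp (-K * (t - r - t1))) (K * Ex) 0 := by
      have := ((((hsub.sub_const t1).const_mul (-K)).exp).const_mul c)
      refine this.congr_deriv ?_
      simp only [sub_zero, hEx]; ring
    have k3 : HasDerivAt (fun r : ℝ => (D y (t - r)) ^ 2) (2 * D y t * (-L)) 0 := by
      have := ((((hsub.sub_const t1).const_mul L).const_add (ρ0 ^ 2)).sub_const (‖y - z‖ ^ 2)).pow 2
      refine this.congr_deriv ?_
      simp [D]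
    have k4 := (k1.sub (k2.mul k3)).add ((hsub.sub_const t1).const_mul η)
    have hm : ∀ᶠ r in 𝓝[>] (0 : ℝ), q (y, t) ≤ q (y, t - r) := by
      have : (0:ℝ) < t - t1 := by linarith
      filter_upwards [Ioo_mem_nhdsGT this] with r hr
      refine hmin ⟨hy, ?_, ?_⟩
      · simp only; linarith [hr.2]
      · simp only; linarith [hr.1]
    have hDp : ∀ᶠ r in 𝓝[>] (0 : ℝ), 0 < D y (t - r) := by
      have : ContinuousAt (fun r : ℝ => D y (t - r)) 0 := by simp only [D]; fun_prop
      apply (this.eventually_const_lt (by simpa using hD)).filter_mono nhdsWithin_le_nhds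
    have := right_min_1d k4 (by
      filter_upwards [hm, hDp] with r hr hr2
      simp only [q, w, max_eq_left hr2.le, max_eq_left hD.le] at hr
      simpa using hr)
    simp only [sub_zero, ← hEx] at this
    linarith
  have halg := barrier_alg (n := n) (D := D y t) (ρ2 := ρ0 ^ 2 + L * (t - t1)) hρ0
    (by have : 0 ≤ L * (t - t1) := mul_nonneg hL (by linarith)
        linarith) hK0 hK
  have hQD : ‖y - z‖ ^ 2 = ρ0 ^ 2 + L * (t - t1) - D y t := by simp only [D]; ring
  have h5 := mul_le_mul_of_nonneg_left halg hEx0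
  rw [hQD] at hsum
  have h6 : Ex * (8 * (ρ0 ^ 2 + L * (t - t1) - D y t) - n * (4 * D y t)) =
    Ex * (8 * (ρ0 ^ 2 + L * (t - t1) - D y t) - 4 * n * D y t) := by ring
  rw [h6] at hsum
  linarith
end LogHeat

namespace LogHeat
open Set Filter Topology Metric

/-- The cross configuration around a point. -/
structure Cross {n : ℕ} (g : EuclideanSpace ℝ (Fin n) → ℝ → ℝ) (z0 : EuclideanSpace ℝ (Fin n))
    (t0 ρ m : ℝ) (Z : Set (EuclideanSpace ℝ (Fin n))) (N : Set ℝ) : Prop where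
  hρ : 0 < ρ
  hρt : ρ < t0
  hm : 0 ≤ m
  hZc : IsClosed Z
  hz0 : z0 ∈ Z
  ht0 : t0 ∈ N
  zero : g z0 t0 = 0
  hZl : ∀ x ∈ Z, ‖x - z0‖ < ρ → ∀ t t', |t - t0| < ρ → |t' - t0| < ρ →
    |g x t - g x t'| ≤ m * |t - t'|
  hNl : ∀ t ∈ N, |t - t0| < ρ → ∀ x x', ‖x - z0‖ < ρ → ‖x' - z0‖ < ρ →
    |g x t - g x' t| ≤ m * ‖x - x'‖
  hc : ∀ x t, ‖x - z0‖ < ρ → |t - t0| < ρ → (x ∉ Z ∨ t ∉ N) →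
    ContinuousAt (fun p : EuclideanSpace ℝ (Fin n) × ℝ => g p.1 p.2) (x, t)

section cross
variable {n : ℕ} {a : ℝ} {g : EuclideanSpace ℝ (Fin n) → ℝ → ℝ} {z0 : EuclideanSpace ℝ (Fin n)}
    {t0 ρ m : ℝ} {Z : Set (EuclideanSpace ℝ (Fin n))} {N : Set ℝ}

lemma Cross.bound (h : Cross g z0 t0 ρ m Z N) {x : EuclideanSpace ℝ (Fin n)} {t r : ℝ}
    (hr : r ≤ ρ) (hx : ‖x - z0‖ < r) (ht : |t - t0| < r) (hc : x ∈ Z ∨ t ∈ N) :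
    |g x t| ≤ 2 * m * r := by
  have hm := h.hm
  have hρ := h.hρ
  rcases hc with hc | hc
  · have h1 := h.hZl x hc (by linarith) t t0 (by linarith) (by simpa using hρ)
    have h2 := h.hNl t0 h.ht0 (by simpa using hρ) x z0 (by linarith) (by simpa using hρ)
    rw [h.zero] at h2
    have h3 : m * |t - t0| ≤ m * r := by gcongr
    have h4 : m * ‖x - z0‖ ≤ m * r := by gcongr
    rw [abs_le] at h1 h2 ⊢
    constructor <;> linarith [h1.1, h1.2, h2.1, h2.2]
  · have h1 := h.hNl t hc (by linarith) x z0 (by linarith) (by simpa using hρ)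
    have h2 := h.hZl z0 h.hz0 (by simpa using hρ) t t0 (by linarith) (by simpa using hρ)
    rw [h.zero] at h2
    have h3 : m * |t - t0| ≤ m * r := by gcongr
    have h4 : m * ‖x - z0‖ ≤ m * r := by gcongr
    rw [abs_le] at h1 h2 ⊢
    constructor <;> linarith [h1.1, h1.2, h2.1, h2.2]

lemma Cross.dist (h : Cross g z0 t0 ρ m Z N) {y : EuclideanSpace ℝ (Fin n)} (hy : y ∉ Z) :
    ∃ d > 0, d ≤ ‖y - z0‖ ∧ (∀ w, ‖w - y‖ < d → w ∉ Z) ∧ ∃ z ∈ Z, ‖y - z‖ < 2 * d := by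
  have hne : Z.Nonempty := ⟨z0, h.hz0⟩
  have hd : 0 < infDist y Z := (h.hZc.notMem_iff_infDist_pos hne).1 hy
  refine ⟨infDist y Z, hd, ?_, ?_, ?_⟩
  · rw [← dist_eq_norm]; exact infDist_le_dist_of_mem h.hz0
  · intro w hw hwZ
    have := infDist_le_dist_of_mem (x := y) hwZ
    rw [dist_comm, dist_eq_norm] at this
    linarith
  · obtain ⟨z, hz, hz2⟩ := (infDist_lt_iff hne).1 (show infDist y Z < 2 * infDist y Z by linarith)
    exact ⟨z, hz, by rwa [← dist_eq_norm]⟩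

lemma Cross.contOn (h : Cross g z0 t0 ρ m Z N) {x0 : EuclideanSpace ℝ (Fin n)} {R t1 t2 : ℝ}
    (hR : ‖x0 - z0‖ + R < ρ) (h1 : t0 - ρ < t1) (h2 : t2 < t0 + ρ)
    (hcc : (∀ w, ‖w - x0‖ ≤ R → w ∉ Z) ∨ (∀ t, t1 ≤ t → t ≤ t2 → t ∉ N)) {x t}
    (hx : ‖x - x0‖ ≤ R) (ht1 : t1 ≤ t) (ht2 : t ≤ t2) :
    ‖x - z0‖ < ρ ∧ |t - t0| < ρ ∧
      ContinuousAt (fun p : EuclideanSpace ℝ (Fin n) × ℝ => g p.1 p.2) (x, t) := by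
  have e1 : ‖x - z0‖ < ρ := by
    have := norm_sub_le_norm_sub_add_norm_sub x x0 z0
    linarith
  have e2 : |t - t0| < ρ := by rw [abs_lt]; constructor <;> linarith
  refine ⟨e1, e2, h.hc x t e1 e2 ?_⟩
  rcases hcc with hcc | hcc
  · exact Or.inl (hcc x hx)
  · exact Or.inr (hcc t ht1 ht2)

/-- Harnack in the cross configuration. -/
lemma Cross.harnack (h : Cross g z0 t0 ρ m Z N) (hn : 1 ≤ n) (ha : a ≠ 0) (hg : Sol n a g) :
    ∃ C > 0, ∀ (x0 : EuclideanSpace ℝ (Fin n)) (R l T : ℝ), 0 < l → l ≤ R ^ 2 → 0 < R →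
      ‖x0 - z0‖ + 2 * R < ρ → t0 - ρ < T - 2 * l → T < t0 + ρ →
      ((∀ w, ‖w - x0‖ ≤ 2 * R → w ∉ Z) ∨ (∀ t, T - 2 * l ≤ t → t ≤ T → t ∉ N)) →
      ∀ x y, ‖x - x0‖ ≤ R / 2 → ‖y - x0‖ ≤ R / 2 → ∀ s t, T - l / 2 ≤ s → s < t → t ≤ T →
        g x s - C * ‖y - x‖ ^ 2 / (t - s) - C * (t - s) / l ≤ g y t := by
  obtain ⟨C, hC, H⟩ := LogHeat.harnack hn ha hg (τm := t0 - ρ) (τM := t0 + ρ) (by linarith [h.hρt])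
  refine ⟨C, hC, fun x0 R l T hl hlR hR hx0 h1 h2 hcc => ?_⟩
  refine H x0 R l T hl hlR hR h1.le h2.le ?_
  rintro ⟨x, t⟩ ⟨hx, ht⟩
  exact (h.contOn hx0 h1 h2 hcc (by simpa [dist_eq_norm] using hx) ht.1 ht.2).2.2.continuousWithinAt

set_option maxHeartbeats 1000000 in
/-- Local boundedness. -/
lemma Cross.bdd (h : Cross g z0 t0 ρ m Z N) (hn : 1 ≤ n) (ha : a ≠ 0) (hg : Sol n a g) :
    ∃ M > 0, ∃ r > 0, ∀ y t, ‖y - z0‖ < r → |t - t0| < r → |g y t| ≤ M := by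
  obtain ⟨C, hC, H⟩ := h.harnack hn ha hg
  have hρ := h.hρ
  have hm := h.hm
  refine ⟨2 * m * ρ + 600 * C, by positivity, min 1 (ρ / 32), by positivity, ?_⟩
  intro y t hy ht
  have hr1 : min 1 (ρ / 32) ≤ 1 := min_le_left _ _
  have hr2 : min 1 (ρ / 32) ≤ ρ / 32 := min_le_right _ _
  set r := min 1 (ρ / 32)
  by_cases hcr : y ∈ Z ∨ t ∈ N
  · have := h.bound (r := ρ) le_rfl (by linarith) (by linarith) hcr
    linarith
  push Not at hcr
  obtain ⟨hyZ, htN⟩ := hcr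
  obtain ⟨d, hd, hdy, hdZ, z, hzZ, hz⟩ := h.dist hyZ
  have hd1 : d < 1 := by linarith
  have hdr : d < ρ / 32 := by linarith
  have hd2 : d ^ 2 < ρ / 32 := by nlinarith
  have hd0 : 0 < d ^ 2 := by positivity
  have ht' := abs_lt.1 ht
  have hzz : ‖z - z0‖ < 3 * (ρ / 32) := by
    have := norm_sub_le_norm_sub_add_norm_sub z y z0
    rw [norm_sub_rev] at hz
    linarith
  -- step at y
  have stepY : ∀ s τ, t - d ^ 2 ≤ s → s < τ → τ ≤ t + d ^ 2 → τ - s ≤ d ^ 2 / 32 →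
      g y s - C ≤ g y τ := by
    intro s τ h1 h2 h3 h4
    have := H y (d / 4) (d ^ 2 / 16) τ (by positivity) (by ring_nf; rfl) (by positivity)
      (by linarith) (by linarith) (by linarith) (Or.inl fun w hw => hdZ w (by linarith)) y y
      (by simp; positivity) (by simp; positivity) s τ (by linarith) h2 le_rfl
    have e : C * (τ - s) / (d ^ 2 / 16) ≤ C := by
      rw [div_le_iff₀ (by positivity)]
      gcongr; linarith
    simp only [sub_self, norm_zero] at this
    norm_num at this
    linarith
  have stepZ : ∀ x x' T, ‖x - z‖ ≤ 2 * d → ‖x' - z‖ ≤ 2 * d → ‖x' - x‖ ≤ 2 * d →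
      t - d ^ 2 / 16 ≤ T → T ≤ t + d ^ 2 → (∀ τ, T - d ^ 2 / 32 ≤ τ → τ ≤ T → τ ∉ N) →
      g x (T - d ^ 2 / 128) - 513 * C ≤ g x' T := by
    intro x x' T hx hx' hxx h1 h2 hN
    have := H z (4 * d) (d ^ 2 / 64) T (by positivity) (by nlinarith) (by positivity)
      (by linarith) (by linarith) (by linarith)
      (Or.inr fun τ h1 h2 => hN τ (by linarith) h2) x x' (by linarith) (by linarith)
      (T - d ^ 2 / 128) T (by linarith) (by linarith) le_rfl
    have e1 : C * (T - (T - d ^ 2 / 128)) / (d ^ 2 / 64) ≤ C := by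
      rw [div_le_iff₀ (by positivity)]
      gcongr; linarith
    have e2 : C * ‖x' - x‖ ^ 2 / (T - (T - d ^ 2 / 128)) ≤ 512 * C := by
      rw [div_le_iff₀ (by linarith)]
      have : ‖x' - x‖ ^ 2 ≤ (2 * d) ^ 2 := by gcongr
      nlinarith
    linarith
  have hyz : ‖y - z‖ ≤ 2 * d := hz.le
  have hzy : ‖z - y‖ ≤ 2 * d := by rw [norm_sub_rev]; exact hz.le
  rw [abs_le]
  constructor
  · by_cases hα : ∃ α ∈ N, t - d ^ 2 / 32 ≤ α ∧ α ≤ t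
    · obtain ⟨α, hαN, h1, h2⟩ := hα
      have hne : α ≠ t := fun e => htN (e ▸ hαN)
      have k := stepY α t (by linarith) (lt_of_le_of_ne h2 hne) (by linarith) (by linarith)
      have := (abs_le.1 (h.bound (x := y) (t := α) (r := ρ) le_rfl (by linarith)
        (by rw [abs_lt]; constructor <;> linarith) (Or.inr hαN))).1
      linarith
    · push Not at hα
      have k := stepZ z y t (by simp; positivity) hyz hyz (by linarith) (by linarith)
        (fun τ h1 h2 hτ => absurd h2 (by have := hα τ hτ h1; linarith))
      have := (abs_le.1 (h.bound (x := z) (t := t - d ^ 2 / 128) (r := ρ) le_rfl (by linarith)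
        (by rw [abs_lt]; constructor <;> linarith) (Or.inl hzZ))).1
      linarith
  · by_cases hα : ∃ α ∈ N, t ≤ α ∧ α ≤ t + d ^ 2 / 32
    · obtain ⟨α, hαN, h1, h2⟩ := hα
      have hne : t ≠ α := fun e => htN (e ▸ hαN)
      have k := stepY t α (by linarith) (lt_of_le_of_ne h1 hne) (by linarith) (by linarith)
      have := (abs_le.1 (h.bound (x := y) (t := α) (r := ρ) le_rfl (by linarith)
        (by rw [abs_lt]; constructor <;> linarith) (Or.inr hαN))).2
      linarith
    · push Not at hα
      have k1 := stepY t (t + 3 * d ^ 2 / 128) (by linarith) (by linarith) (by linarith)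
        (by linarith)
      have k := stepZ y z (t + d ^ 2 / 32) hyz (by simp; positivity) hzy (by linarith)
        (by linarith)
        (fun τ h1 h2 hτ => absurd h2 (by have := hα τ hτ (by linarith); linarith))
      rw [show t + d ^ 2 / 32 - d ^ 2 / 128 = t + 3 * d ^ 2 / 128 by ring] at k
      have := (abs_le.1 (h.bound (x := z) (t := t + d ^ 2 / 32) (r := ρ) le_rfl (by linarith)
        (by rw [abs_lt]; constructor <;> linarith) (Or.inl hzZ))).2
      linarith

end cross
end LogHeat

namespace LogHeat
open Set Filter Topology Metric

section cross
variable {n : ℕ} {a : ℝ} {g : EuclideanSpace ℝ (Fin n) → ℝ → ℝ} {z0 : EuclideanSpace ℝ (Fin n)}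
    {t0 ρ m : ℝ} {Z : Set (EuclideanSpace ℝ (Fin n))} {N : Set ℝ}

set_option maxHeartbeats 1000000 in
/-- Geometric propagation of positivity. -/
lemma Cross.geo (h : Cross g z0 t0 ρ m Z N) (hn : 1 ≤ n) (ha : a ≠ 0) (hg : Sol n a g)
    {S : ℝ} (hS : 0 < S) :
    ∃ c > 0, c ≤ 1 ∧ ∀ r > 0, ∃ r' > 0, r' ≤ r ∧ ∀ (V : EuclideanSpace ℝ (Fin n) → ℝ → ℝ) (κ : ℝ),
      0 ≤ κ → (∀ x t, ‖x - z0‖ < r → |t - t0| < r → 0 ≤ V x t) →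
      (∀ x t, ‖x - z0‖ < r → |t - t0| < r → |g x t| ≤ S / 2 → κ ≤ V x t) →
      (∀ x t, ContinuousAt (fun p : EuclideanSpace ℝ (Fin n) × ℝ => g p.1 p.2) (x, t) →
        ContinuousAt (fun p : EuclideanSpace ℝ (Fin n) × ℝ => V p.1 p.2) (x, t)) →
      (∀ t1 t2, t0 - ρ < t1 → t2 < t0 + ρ → Super V t1 t2) →
      ∀ y t, ‖y - z0‖ < r' → |t - t0| < r' → c * κ ≤ V y t := by
  obtain ⟨C, hC, H⟩ := h.harnack hn ha hg
  have hρ := h.hρ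
  have hm := h.hm
  obtain ⟨θ, hθ0, hθ1, hθ2⟩ : ∃ θ : ℝ, 0 < θ ∧ θ ≤ 1 / 2 ∧ C * θ ≤ S / 8 := by
    refine ⟨min (1 / 2) (S / (8 * C)), by positivity, min_le_left _ _, ?_⟩
    calc C * min (1 / 2) (S / (8 * C)) ≤ C * (S / (8 * C)) := by gcongr; exact min_le_right _ _
      _ = S / 8 := by field_simp
  obtain ⟨ε, hε0, hε1, hε2⟩ : ∃ ε : ℝ, 0 < ε ∧ ε ≤ 1 / 2 ∧ 64 * C * ε ^ 2 ≤ θ * S := by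
    refine ⟨min (1 / 2) (√(θ * S / (64 * C))), by positivity, min_le_left _ _, ?_⟩
    calc 64 * C * (min (1 / 2) (√(θ * S / (64 * C)))) ^ 2
        ≤ 64 * C * (√(θ * S / (64 * C))) ^ 2 := by gcongr; exact min_le_right _ _
      _ = θ * S := by rw [Real.sq_sqrt (by positivity)]; field_simp
  set c1 := Real.exp (-((8 + 4 * n : ℝ) ^ 2 / 8)) with hc1
  set c2 := 16 / ε ^ 4 * Real.exp (-((40 + 4 * n : ℝ) ^ 2 / (64 * ε ^ 2))) with hc2
  have hc10 : 0 < c1 := Real.exp_pos _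
  have hc20 : 0 < c2 := by positivity
  refine ⟨min 1 (min c1 c2), by positivity, min_le_left _ _, fun r hr => ?_⟩
  refine ⟨min (min 1 (ρ / 32)) (min (r / 32) (S / (128 * (m + 1)))), by positivity, ?_, ?_⟩
  · refine (min_le_right _ _).trans ((min_le_left _ _).trans ?_); linarith
  intro V κ hκ hV0 hVκ hVc hVs y t hy ht
  have hr1 : min (min 1 (ρ / 32)) (min (r / 32) (S / (128 * (m + 1)))) ≤ 1 :=
    (min_le_left _ _).trans (min_le_left _ _)
  have hr2 : min (min 1 (ρ / 32)) (min (r / 32) (S / (128 * (m + 1)))) ≤ ρ / 32 :=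
    (min_le_left _ _).trans (min_le_right _ _)
  have hr3 : min (min 1 (ρ / 32)) (min (r / 32) (S / (128 * (m + 1)))) ≤ r / 32 :=
    (min_le_right _ _).trans (min_le_left _ _)
  have hr4 : min (min 1 (ρ / 32)) (min (r / 32) (S / (128 * (m + 1)))) ≤ S / (128 * (m + 1)) :=
    (min_le_right _ _).trans (min_le_right _ _)
  have hr0 : 0 < min (min 1 (ρ / 32)) (min (r / 32) (S / (128 * (m + 1)))) := by positivity
  set r' := min (min 1 (ρ / 32)) (min (r / 32) (S / (128 * (m + 1))))
  have hcb : ∀ x τ, ‖x - z0‖ < 16 * r' → |τ - t0| < 16 * r' → (x ∈ Z ∨ τ ∈ N) →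
      |g x τ| ≤ S / 4 := by
    intro x τ hx hτ hc
    refine (h.bound (r := 16 * r') (by linarith) hx hτ hc).trans ?_
    have : r' * (128 * (m + 1)) ≤ S := (le_div_iff₀ (by positivity)).1 hr4
    nlinarith
  by_cases hcr : y ∈ Z ∨ t ∈ N
  · have h1 := hcb y t (by linarith) (by linarith) hcr
    have h2 := hVκ y t (by linarith) (by linarith) (by linarith)
    have : min 1 (min c1 c2) * κ ≤ 1 * κ := by gcongr; exact min_le_left _ _
    linarith
  push Not at hcr
  obtain ⟨hyZ, htN⟩ := hcr
  obtain ⟨d, hd, hdy, hdZ, z, hzZ, hz⟩ := h.dist hyZ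
  have hd1 : d < 1 := by linarith
  have hdr : d < r' := by linarith
  have hd2 : d ^ 2 < r' := by nlinarith
  have hd0 : 0 < d ^ 2 := by positivity
  have ht' := abs_lt.1 ht
  have hzz : ‖z - z0‖ < 3 * r' := by
    have := norm_sub_le_norm_sub_add_norm_sub z y z0
    rw [norm_sub_rev] at hz
    linarith
  by_cases hα : ∃ α ∈ N, t - d ^ 2 ≤ α ∧ α ≤ t
  · obtain ⟨α, hαN, h1, h2⟩ := hα
    have hne : α < t := lt_of_le_of_ne h2 fun e => htN (e ▸ hαN)
    have hK : 0 < (8 + 4 * n : ℝ) ^ 2 / (8 * d ^ 2) := by positivity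
    have hball : ∀ x, ‖x - y‖ ≤ d / 2 → ‖x - z0‖ < 2 * r' := fun x hx => by
      have := norm_sub_le_norm_sub_add_norm_sub x y z0
      linarith
    have B := barrier (V := V) (z := y) (ρ0 := d / 2) (L := 0)
      (K := (8 + 4 * n : ℝ) ^ 2 / (8 * d ^ 2)) (κ := κ) (t1 := α) (t2 := t) (ρM := d / 2)
      (by positivity) le_rfl hK (by apply le_of_eq; field_simp; ring) hne (by positivity)
      (by linarith) (by
        rintro ⟨x, τ⟩ ⟨hx, hτ⟩
        refine (hVc x τ ?_).continuousWithinAt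
        exact (h.contOn (x0 := y) (R := d / 2) (t1 := α) (t2 := t) (by linarith) (by linarith)
          (by linarith) (Or.inl fun w hw => hdZ w (by linarith))
          (by simpa [dist_eq_norm] using hx) hτ.1 hτ.2).2.2)
      (fun x τ hx h3 h4 => hV0 x τ (by linarith [hball x hx])
        (by rw [abs_lt]; constructor <;> linarith)) hκ
      (fun x hx => by
        have hαt : |α - t0| < 2 * r' := by rw [abs_lt]; constructor <;> linarith
        have := hcb x α (by linarith [hball x hx]) (by linarith) (Or.inr hαN)
        exact hVκ x α (by linarith [hball x hx]) (by linarith) (by linarith))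
      (hVs α t (by linarith) (by linarith)) y (by simp; positivity)
    refine le_trans ?_ B
    have e1 : κ / (d / 2) ^ 4 * Real.exp (-((8 + 4 * n : ℝ) ^ 2 / (8 * d ^ 2)) * (t - α)) *
      ((d / 2) ^ 2 + 0 * (t - α) - ‖y - y‖ ^ 2) ^ 2 =
      κ * Real.exp (-((8 + 4 * n : ℝ) ^ 2 / (8 * d ^ 2)) * (t - α)) := by
      simp; field_simp
    rw [e1, mul_comm]
    gcongr
    refine ((min_le_right _ _).trans (min_le_left _ _)).trans ?_
    rw [hc1]
    apply Real.exp_le_exp.2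
    have e2 : (8 + 4 * n : ℝ) ^ 2 / 8 = (8 + 4 * n : ℝ) ^ 2 / (8 * d ^ 2) * d ^ 2 := by
      field_simp
    rw [e2, neg_mul, neg_le_neg_iff]
    gcongr; linarith
  · push Not at hα
    have hNf : ∀ τ, t - d ^ 2 ≤ τ → τ ≤ t → τ ∉ N := fun τ h1 h2 h3 => by
      have := hα τ h3 h1; linarith
    set T := t - d ^ 2 / 2 with hT
    set l := d ^ 2 / 8 with hl
    have hl0 : 0 < l := by positivity
    have hld : l ≤ d ^ 2 := by linarith
    have hθl : θ * l ≤ l / 2 := by nlinarith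
    have hθl0 : 0 < θ * l := by positivity
    have hball : ∀ x, ‖x - z‖ ≤ 3 * d → ‖x - z0‖ < 6 * r' := fun x hx => by
      have := norm_sub_le_norm_sub_add_norm_sub x z z0
      linarith
    have hεd : ε * d ≤ d / 2 := by nlinarith
    have cost : ∀ q : ℝ, 0 ≤ q → q ≤ ε * d → C * q ^ 2 / (θ * l) + C * (θ * l) / l ≤ S / 4 := by
      intro q hq0 hq
      have e1 : C * (θ * l) / l ≤ S / 8 := by
        rw [← mul_assoc, mul_div_cancel_right₀ _ hl0.ne']; exact hθ2
      have e2 : C * q ^ 2 / (θ * l) ≤ S / 8 := by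
        rw [div_le_iff₀ hθl0]
        have : q ^ 2 ≤ (ε * d) ^ 2 := by gcongr
        calc C * q ^ 2 ≤ C * (ε * d) ^ 2 := by gcongr
          _ = (64 * C * ε ^ 2) * (d ^ 2 / 64) := by ring
          _ ≤ (θ * S) * (d ^ 2 / 64) := by gcongr
          _ = S / 8 * (θ * l) := by rw [hl]; ring
      linarith
    have near : ∀ x, ‖x - z‖ ≤ ε * d → |g x T| ≤ S / 2 := by
      intro x hx
      have hzt1 := abs_le.1 (hcb z (T - θ * l) (by linarith)
        (by rw [abs_lt]; constructor <;> linarith) (Or.inl hzZ))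
      have hzt2 := abs_le.1 (hcb z (T + θ * l) (by linarith)
        (by rw [abs_lt]; constructor <;> linarith) (Or.inl hzZ))
      have k1 := H z d l T hl0 hld hd (by linarith) (by linarith) (by linarith)
        (Or.inr fun τ h1 h2 => hNf τ (by linarith) (by linarith)) z x (by simp; positivity)
        (by linarith) (T - θ * l) T (by linarith) (by linarith) le_rfl
      have k2 := H z d l (T + θ * l) hl0 hld hd (by linarith) (by linarith) (by linarith)
        (Or.inr fun τ h1 h2 => hNf τ (by linarith) (by linarith)) x z (by linarith)
        (by simp; positivity) T (T + θ * l) (by linarith) (by linarith) le_rfl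
      have k3 := cost _ (norm_nonneg _) hx
      rw [show T - (T - θ * l) = θ * l by ring] at k1
      rw [show T + θ * l - T = θ * l by ring, norm_sub_rev z x] at k2
      rw [abs_le]
      constructor <;> linarith [hzt1.1, hzt2.2]
    have hK : 0 < (40 + 4 * n : ℝ) ^ 2 / (32 * ε ^ 2 * d ^ 2) := by positivity
    have hεd2 : (ε * d) ^ 2 ≤ d ^ 2 := by
      have : ε * d ≤ d := by linarith
      gcongr
    have hyz2 : ‖y - z‖ ^ 2 ≤ 4 * d ^ 2 := by
      have : ‖y - z‖ ^ 2 ≤ (2 * d) ^ 2 := by gcongr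
      linarith
    have B := barrier (V := V) (z := z) (ρ0 := ε * d) (L := 16)
      (K := (40 + 4 * n : ℝ) ^ 2 / (32 * ε ^ 2 * d ^ 2)) (κ := κ) (t1 := T) (t2 := t) (ρM := 3 * d)
      (by positivity) (by norm_num) hK (by apply le_of_eq; field_simp; ring) (by linarith)
      (by positivity) (by rw [hT]; nlinarith) (by
        rintro ⟨x, τ⟩ ⟨hx, hτ⟩
        refine (hVc x τ ?_).continuousWithinAt
        exact (h.contOn (x0 := z) (R := 3 * d) (t1 := T) (t2 := t) (by linarith) (by linarith)
          (by linarith) (Or.inr fun τ h1 h2 => hNf τ (by linarith) (by linarith))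
          (by simpa [dist_eq_norm] using hx) hτ.1 hτ.2).2.2)
      (fun x τ hx h3 h4 => hV0 x τ (by linarith [hball x hx])
        (by rw [abs_lt]; constructor <;> linarith)) hκ
      (fun x hx => hVκ x T (by linarith [hball x (by linarith)])
        (by rw [abs_lt]; constructor <;> linarith) (near x hx))
      (hVs T t (by linarith) (by linarith)) y (by rw [hT]; nlinarith [sq_nonneg (ε * d)])
    refine le_trans ?_ B
    have e0 : t - T = d ^ 2 / 2 := by rw [hT]; ring
    rw [e0]
    have e1 : (4 * d ^ 2) ^ 2 ≤ ((ε * d) ^ 2 + 16 * (d ^ 2 / 2) - ‖y - z‖ ^ 2) ^ 2 := by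
      have := sq_nonneg (ε * d)
      gcongr; linarith
    have e2 : -((40 + 4 * n : ℝ) ^ 2 / (32 * ε ^ 2 * d ^ 2)) * (d ^ 2 / 2) =
      -((40 + 4 * n : ℝ) ^ 2 / (64 * ε ^ 2)) := by field_simp; norm_num
    rw [e2]
    calc min 1 (min c1 c2) * κ ≤ c2 * κ := by
          gcongr; exact (min_le_right _ _).trans (min_le_right _ _)
      _ = κ / (ε * d) ^ 4 * Real.exp (-((40 + 4 * n : ℝ) ^ 2 / (64 * ε ^ 2))) *
        (4 * d ^ 2) ^ 2 := by rw [hc2]; field_simp; norm_num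
      _ ≤ _ := by gcongr

end cross
end LogHeat

namespace LogHeat
open Set Filter Topology Metric

lemma Sol.super_comp {n : ℕ} {a : ℝ} {g : EuclideanSpace ℝ (Fin n) → ℝ → ℝ} (hg : Sol n a g)
    {f f' f'' : ℝ → ℝ} (hfc : ContDiff ℝ 2 f) (hf : ∀ s, HasDerivAt f (f' s) s)
    (hf' : ∀ s, HasDerivAt f' (f'' s) s) {t1 t2 : ℝ} (ht1 : 0 ≤ t1)
    (hle : ∀ s t, t1 < t → t ≤ t2 → f'' s ≤ f' s * Real.exp (a * t)) :
    Super (fun x t => f (g x t)) t1 t2 := by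
  intro x t h1 h2
  have ht : 0 < t := by linarith
  refine ⟨hfc.comp (hg.space t ht), f' (g x t) * deriv (g x) t,
    (hf (g x t)).comp t (hg.hasDerivAt x ht), ?_⟩
  have e : ∀ i, pdd (fun y => f (g y t)) i x =
      f' (g x t) * pdd (fun y => g y t) i x + f'' (g x t) * (pd (fun y => g y t) i x) ^ 2 :=
    fun i => pdd_comp (v := fun y => g y t) (hg.space t ht) (fun y => hf _) (hf' _) i
  simp only [e]
  rw [Finset.sum_add_distrib, ← Finset.mul_sum, ← Finset.mul_sum, hg.eqn x t ht, mul_add,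
    ← mul_assoc]
  have h0 : 0 ≤ ∑ i, (pd (fun y => g y t) i x) ^ 2 := Finset.sum_nonneg fun i _ => sq_nonneg _
  have := mul_le_mul_of_nonneg_right (hle (g x t) t h1 h2) h0
  linarith

lemma Sol.sub_const {n : ℕ} {a : ℝ} {g : EuclideanSpace ℝ (Fin n) → ℝ → ℝ} (hg : Sol n a g)
    (c : ℝ) : Sol n a (fun x t => g x t - c) := by
  have e1 : ∀ t i, pd (fun y => g y t - c) i = pd (fun y => g y t) i := by
    intro t i; ext x; simp [pd, fderiv_sub_const]
  refine ⟨fun t ht => (hg.space t ht).sub contDiff_const,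
    fun x => (hg.time x).sub contDiffOn_const, fun x t ht => ?_⟩
  have e2 : deriv (fun t => g x t - c) t = deriv (g x) t := by simp
  rw [e2, hg.eqn x t ht]
  simp only [pdd, e1]

section cross
variable {n : ℕ} {a : ℝ} {g : EuclideanSpace ℝ (Fin n) → ℝ → ℝ} {z0 : EuclideanSpace ℝ (Fin n)}
    {t0 ρ m : ℝ} {Z : Set (EuclideanSpace ℝ (Fin n))} {N : Set ℝ}

/-- Improvement of the oscillation bound. -/
lemma Cross.improve (h : Cross g z0 t0 ρ m Z N) (hn : 1 ≤ n) (ha : a ≠ 0) (hg : Sol n a g)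
    {S M0 : ℝ} (hS : 0 < S) : ∃ c > 0, ∀ M, S ≤ M → M ≤ M0 →
      (∃ r > 0, ∀ y t, ‖y - z0‖ < r → |t - t0| < r → |g y t| ≤ M) →
      (∃ r > 0, ∀ y t, ‖y - z0‖ < r → |t - t0| < r → |g y t| ≤ M - c) := by
  obtain ⟨c0, hc0, hc01, H⟩ := h.geo hn ha hg hS
  obtain ⟨_, lam, _, hlam, hσ⟩ := exp_bounds a (t0 - ρ) (t0 + ρ)
  have hρt := h.hρt
  refine ⟨c0 * (S / 2) * Real.exp (-lam * M0), by positivity, ?_⟩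
  rintro M hSM hMM ⟨r, hr, hb⟩
  obtain ⟨r', hr', -, H⟩ := H r hr
  refine ⟨r', hr', fun y t hy ht => ?_⟩
  have hcle : c0 * (S / 2) * Real.exp (-lam * M0) ≤ c0 * (S / 2) := by
    have : Real.exp (-lam * M0) ≤ 1 := by
      rw [Real.exp_le_one_iff]; nlinarith
    have h2 : 0 < c0 * (S / 2) := by positivity
    nlinarith
  rw [abs_le]
  constructor
  · have k := H (fun x t => g x t + M) (S / 2) (by positivity)
      (fun x τ hx hτ => by linarith [(abs_le.1 (hb x τ hx hτ)).1])
      (fun x τ hx hτ hs => by linarith [(abs_le.1 hs).1])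
      (fun x τ hc => hc.add continuousAt_const)
      (fun t1 t2 h1 h2 => hg.super_comp (f := fun s => s + M) (f' := fun _ => 1)
        (f'' := fun _ => 0) (by fun_prop) (fun s => (hasDerivAt_id s).add_const M)
        (fun s => hasDerivAt_const s 1) (by linarith)
        (fun s t _ _ => by simpa using (Real.exp_pos _).le)) y t hy ht
    linarith
  · have hfd : ∀ s, HasDerivAt (fun s : ℝ => Real.exp (lam * s)) (lam * Real.exp (lam * s)) s := by
      intro s
      have := ((hasDerivAt_id s).const_mul lam).exp
      refine this.congr_deriv ?_
      simp [mul_comm]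
    have k := H (fun x t => Real.exp (lam * M) - Real.exp (lam * g x t)) (lam * (S / 2))
      (by positivity)
      (fun x τ hx hτ => by
        have := (abs_le.1 (hb x τ hx hτ)).2
        have : Real.exp (lam * g x τ) ≤ Real.exp (lam * M) := by gcongr
        linarith)
      (fun x τ hx hτ hs => by
        have h1 := (abs_le.1 hs).2
        have h2 : Real.exp (lam * g x τ) ≤ Real.exp (lam * (S / 2)) := by gcongr
        have h3 : Real.exp (lam * S) ≤ Real.exp (lam * M) := by gcongr
        have h4 : Real.exp (lam * S) = Real.exp (lam * (S / 2)) * Real.exp (lam * (S / 2)) := by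
          rw [← Real.exp_add]; ring_nf
        have h5 := Real.add_one_le_exp (lam * (S / 2))
        have h6 : 0 < lam * (S / 2) := by positivity
        nlinarith)
      (fun x τ hc => by
        have : ContinuousAt (fun p : EuclideanSpace ℝ (Fin n) × ℝ =>
          Real.exp (lam * g p.1 p.2)) (x, τ) := (continuousAt_const.mul hc).rexp
        exact continuousAt_const.sub this)
      (fun t1 t2 h1 h2 => hg.super_comp (f := fun s => Real.exp (lam * M) - Real.exp (lam * s))
        (f' := fun s => -(lam * Real.exp (lam * s)))
        (f'' := fun s => -(lam * (lam * Real.exp (lam * s)))) (by fun_prop)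
        (fun s => (hfd s).const_sub _)
        (fun s => ((hfd s).const_mul lam).neg) (by linarith)
        (fun s t h3 h4 => by
          have h5 := (hσ t ⟨by linarith, by linarith⟩).2
          have h6 : 0 < lam * Real.exp (lam * s) := by positivity
          nlinarith)) y t hy ht
    set E := Real.exp (-lam * M0) with hE
    have h1 : Real.exp (lam * g y t) = Real.exp (lam * M) * Real.exp (lam * (g y t - M)) := by
      rw [← Real.exp_add]; ring_nf
    have h2 := Real.add_one_le_exp (lam * (g y t - M))
    have h3 : Real.exp (lam * M) * E ≤ 1 := by
      rw [hE, ← Real.exp_add, Real.exp_le_one_iff]; nlinarith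
    have hpos := Real.exp_pos (lam * M)
    by_contra hcon
    push Not at hcon
    have h4 : Real.exp (lam * M) * (lam * (g y t - M) + 1) ≤ Real.exp (lam * g y t) := by
      rw [h1]; gcongr
    have h5 : Real.exp (lam * M) * lam * (M - g y t) < Real.exp (lam * M) * lam *
      (c0 * (S / 2) * E) := by
      apply mul_lt_mul_of_pos_left _ (by positivity); linarith
    have h6 : Real.exp (lam * M) * lam * (c0 * (S / 2) * E) ≤ c0 * (lam * (S / 2)) := by
      have : 0 < c0 * (lam * (S / 2)) := by positivity
      calc _ = (c0 * (lam * (S / 2))) * (Real.exp (lam * M) * E) := by ring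
        _ ≤ (c0 * (lam * (S / 2))) * 1 := by gcongr
        _ = _ := mul_one _
    linarith

lemma Cross.small (h : Cross g z0 t0 ρ m Z N) (hn : 1 ≤ n) (ha : a ≠ 0) (hg : Sol n a g)
    {δ : ℝ} (hδ : 0 < δ) : ∃ r > 0, ∀ y t, ‖y - z0‖ < r → |t - t0| < r → |g y t| < δ := by
  obtain ⟨M1, hM1, hM1r⟩ := h.bdd hn ha hg
  set Q : Set ℝ := {M | ∃ r > 0, ∀ y t, ‖y - z0‖ < r → |t - t0| < r → |g y t| ≤ M} with hQ
  have hQb : BddBelow Q := by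
    refine ⟨0, ?_⟩
    rintro M ⟨r, hr, hM⟩
    exact (abs_nonneg _).trans (hM z0 t0 (by simpa using hr) (by simpa using hr))
  have hQne : Q.Nonempty := ⟨M1, hM1r⟩
  have hS : sInf Q ≤ 0 := by
    by_contra hS
    push Not at hS
    obtain ⟨c, hc, hI⟩ := h.improve hn ha hg (M0 := M1) hS
    by_cases hcase : M1 < sInf Q + c
    · have := hI M1 (csInf_le hQb hM1r) le_rfl hM1r
      have := csInf_le hQb this
      linarith
    · push Not at hcase
      obtain ⟨M, hM, hMl⟩ := exists_lt_of_csInf_lt hQne (show sInf Q < sInf Q + c by linarith)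
      have := hI M (csInf_le hQb hM) (by linarith) hM
      have := csInf_le hQb this
      linarith
  obtain ⟨M, ⟨r, hr, hM⟩, hMl⟩ := exists_lt_of_csInf_lt hQne (show sInf Q < δ by linarith)
  exact ⟨r, hr, fun y t hy ht => (hM y t hy ht).trans_lt hMl⟩

lemma Cross.cont (h : Cross g z0 t0 ρ m Z N) (hn : 1 ≤ n) (ha : a ≠ 0) (hg : Sol n a g) :
    ContinuousAt (fun p : EuclideanSpace ℝ (Fin n) × ℝ => g p.1 p.2) (z0, t0) := by
  rw [Metric.continuousAt_iff]
  intro δ hδ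
  obtain ⟨r, hr, H⟩ := h.small hn ha hg hδ
  refine ⟨r, hr, ?_⟩
  rintro ⟨y, t⟩ hyt
  rw [Prod.dist_eq, max_lt_iff] at hyt
  have := H y t (by simpa [dist_eq_norm] using hyt.1) (by simpa [Real.dist_eq] using hyt.2)
  simp only [h.zero]
  simpa [Real.dist_eq] using this

end cross

lemma cross_cont {n : ℕ} {a : ℝ} {g : EuclideanSpace ℝ (Fin n) → ℝ → ℝ} (hn : 1 ≤ n) (ha : a ≠ 0)
    (hg : Sol n a g) {z0 : EuclideanSpace ℝ (Fin n)}
    {t0 ρ m : ℝ} {Z : Set (EuclideanSpace ℝ (Fin n))} {N : Set ℝ} (hρ : 0 < ρ)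
    (hρt : ρ < t0) (hm : 0 ≤ m) (hZc : IsClosed Z) (hz0 : z0 ∈ Z) (ht0 : t0 ∈ N)
    (hZl : ∀ x ∈ Z, ‖x - z0‖ < ρ → ∀ t t', |t - t0| < ρ → |t' - t0| < ρ →
      |g x t - g x t'| ≤ m * |t - t'|)
    (hNl : ∀ t ∈ N, |t - t0| < ρ → ∀ x x', ‖x - z0‖ < ρ → ‖x' - z0‖ < ρ →
      |g x t - g x' t| ≤ m * ‖x - x'‖)
    (hc : ∀ x t, ‖x - z0‖ < ρ → |t - t0| < ρ → (x ∉ Z ∨ t ∉ N) →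
      ContinuousAt (fun p : EuclideanSpace ℝ (Fin n) × ℝ => g p.1 p.2) (x, t)) :
    ContinuousAt (fun p : EuclideanSpace ℝ (Fin n) × ℝ => g p.1 p.2) (z0, t0) := by
  have hX : Cross (fun x t => g x t - g z0 t0) z0 t0 ρ m Z N := by
    refine ⟨hρ, hρt, hm, hZc, hz0, ht0, by simp, ?_, ?_, ?_⟩
    · intro x hx h1 t t' h2 h3
      simpa using hZl x hx h1 t t' h2 h3
    · intro t ht h1 x x' h2 h3
      simpa using hNl t ht h1 x x' h2 h3
    · intro x t h1 h2 h3
      exact (hc x t h1 h2 h3).sub continuousAt_const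
  have := (hX.cont hn ha (hg.sub_const _)).add (continuousAt_const (y := g z0 t0))
  exact this.congr (Eventually.of_forall fun p => by simp)

end LogHeat

namespace LogHeat
open Set Filter Topology Metric

/-- Local Lipschitz bound in ball form. -/
lemma lip_ball {F : Type*} [NormedAddCommGroup F] [NormedSpace ℝ F] {f : F → ℝ} {x : F}
    (hf : ContDiffAt ℝ 1 f x) : ∃ m0 : ℕ, ∀ m : ℕ, m0 ≤ m → ∀ y y', ‖y - x‖ < 1 / (m + 1) →
      ‖y' - x‖ < 1 / (m + 1) → |f y - f y'| ≤ (m + 1) * ‖y - y'‖ := by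
  obtain ⟨K, s, hs, hL⟩ := hf.exists_lipschitzOnWith
  obtain ⟨ε, hε, hb⟩ := Metric.mem_nhds_iff.1 hs
  obtain ⟨k, hk⟩ := exists_nat_ge ((K : ℝ) + 1 / ε)
  have hKn : (0 : ℝ) ≤ K := K.2
  have hεi : 0 < 1 / ε := by positivity
  refine ⟨k, fun m hm y y' hy hy' => ?_⟩
  have hkm : (k : ℝ) ≤ m := by exact_mod_cast hm
  have h1 : 1 / ((m : ℝ) + 1) < ε := by
    rw [div_lt_comm₀ (by positivity) hε]
    linarith
  have h2 := hL.dist_le_mul y (hb (by rw [mem_ball, dist_eq_norm]; linarith)) y'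
    (hb (by rw [mem_ball, dist_eq_norm]; linarith))
  rw [Real.dist_eq, dist_eq_norm] at h2
  refine h2.trans ?_
  gcongr; linarith

set_option maxHeartbeats 1000000 in
/-- Separately regular solutions are jointly continuous. -/
lemma joint_cont {n : ℕ} {a : ℝ} {g : EuclideanSpace ℝ (Fin n) → ℝ → ℝ} (hn : 1 ≤ n) (ha : a ≠ 0)
    (hg : Sol n a g) (x : EuclideanSpace ℝ (Fin n)) (t : ℝ) (ht : 0 < t) :
    ContinuousAt (fun p : EuclideanSpace ℝ (Fin n) × ℝ => g p.1 p.2) (x, t) := by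
  set G : EuclideanSpace ℝ (Fin n) × ℝ → ℝ := fun p => g p.1 p.2 with hG
  set U : Set (EuclideanSpace ℝ (Fin n) × ℝ) := {p | ∀ᶠ q in 𝓝 p, ContinuousAt G q} with hU
  have hUo : IsOpen U := isOpen_setOfPred_eventually_nhds
  set P : Set (EuclideanSpace ℝ (Fin n) × ℝ) := {p | 0 < p.2} with hP
  have hPo : IsOpen P := isOpen_lt continuous_const continuous_snd
  set K : Set (EuclideanSpace ℝ (Fin n) × ℝ) := P ∩ Uᶜ with hK
  have hnK : ∀ p ∈ P, p ∉ K → ContinuousAt G p := by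
    intro p hp hpK
    have : p ∈ U := by by_contra hh; exact hpK ⟨hp, hh⟩
    exact this.self_of_nhds
  by_cases hKne : K.Nonempty
  swap
  · rw [not_nonempty_iff_eq_empty] at hKne
    exact hnK (x, t) ht (by rw [hKne]; exact notMem_empty _)
  exfalso
  have hKl : IsLocallyClosed K := ⟨P, Uᶜ, hPo, hUo.isClosed_compl, rfl⟩
  have : LocallyCompactSpace K := hKl.locallyCompactSpace
  have : Nonempty K := hKne.to_subtype
  have hgt : ∀ x, ContinuousOn (g x) (Ioi 0) := fun x => (hg.time x).continuousOn
  let FA : ℕ → Set K := fun m => {p |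
    (∀ t t', 0 < t → 0 < t' → ‖t - p.1.2‖ < 1 / ((m : ℝ) + 1) → ‖t' - p.1.2‖ < 1 / ((m : ℝ) + 1) →
      |g p.1.1 t - g p.1.1 t'| ≤ (m + 1) * ‖t - t'‖)}
  let FB : ℕ → Set K := fun m => {p |
    (∀ x x', ‖x - p.1.1‖ < 1 / ((m : ℝ) + 1) → ‖x' - p.1.1‖ < 1 / ((m : ℝ) + 1) →
      |g x p.1.2 - g x' p.1.2| ≤ (m + 1) * ‖x - x'‖)}
  let F : ℕ → Set K := fun m => FA m ∩ FB m
  have hFc : ∀ m, IsClosed (F m) := by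
    intro m
    refine IsClosed.inter ?_ ?_
    · simp only [FA, ofPred_forall]
      refine isClosed_iInter fun t => isClosed_iInter fun t' => isClosed_iInter fun h1 =>
        isClosed_iInter fun h2 => ?_
      refine isClosed_imp (isOpen_lt (by fun_prop) continuous_const)
        (isClosed_imp (isOpen_lt (by fun_prop) continuous_const)
        (isClosed_le ?_ continuous_const))
      have c1 := (hg.space t h1).continuous
      have c2 := (hg.space t' h2).continuous
      fun_prop
    · simp only [FB, ofPred_forall]
      refine isClosed_iInter fun t => isClosed_iInter fun t' => ?_
      refine isClosed_imp (isOpen_lt (by fun_prop) continuous_const)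
        (isClosed_imp (isOpen_lt (by fun_prop) continuous_const)
        (isClosed_le ?_ continuous_const))
      have c : ∀ x, Continuous (fun p : K => g x p.1.2) := fun x =>
        (hgt x).comp_continuous (by fun_prop) (fun p => p.2.1)
      exact ((c t).sub (c t')).abs
  have hFu : ⋃ m, F m = univ := by
    rw [eq_univ_iff_forall]
    rintro ⟨⟨x, t⟩, hp⟩
    have ht : 0 < t := hp.1
    obtain ⟨m1, H1⟩ := lip_ball ((hg.time x).contDiffAt (Ioi_mem_nhds ht))
    obtain ⟨m2, H2⟩ := lip_ball ((hg.space t ht).contDiffAt (x := x) |>.of_le (by norm_num))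
    rw [mem_iUnion]
    exact ⟨max m1 m2, fun t t' _ _ h1 h2 => H1 _ (le_max_left _ _) t t' h1 h2,
      fun x x' h1 h2 => H2 _ (le_max_right _ _) x x' h1 h2⟩
  obtain ⟨m, ⟨⟨z, τ⟩, hp0⟩, hint⟩ := nonempty_interior_of_iUnion_of_closed hFc hFu
  have hτ : 0 < τ := hp0.1
  obtain ⟨δ, hδ, hball⟩ := Metric.mem_nhds_iff.1 (mem_interior_iff_mem_nhds.1 hint)
  have hmp : (0:ℝ) < 1 / ((m:ℝ) + 1) := by positivity
  obtain ⟨r, hr, hr1, hr2, hr3⟩ : ∃ r > 0, 4 * r < δ ∧ 8 * r < 1 / ((m:ℝ) + 1) ∧ 8 * r < τ := by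
    refine ⟨min (min δ (1 / ((m:ℝ) + 1))) τ / 16, by positivity, ?_, ?_, ?_⟩
    · have : min (min δ (1 / ((m:ℝ) + 1))) τ ≤ δ := (min_le_left _ _).trans (min_le_left _ _)
      linarith
    · have : min (min δ (1 / ((m:ℝ) + 1))) τ ≤ 1 / ((m:ℝ) + 1) :=
        (min_le_left _ _).trans (min_le_right _ _)
      linarith
    · have : min (min δ (1 / ((m:ℝ) + 1))) τ ≤ τ := min_le_right _ _
      linarith
  set Z : Set (EuclideanSpace ℝ (Fin n)) := {x | ∀ t t', |t - τ| < 2 * r → |t' - τ| < 2 * r →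
    |g x t - g x t'| ≤ (m + 1) * |t - t'|} with hZ
  set N : Set ℝ := {t | ∀ x x', ‖x - z‖ < 2 * r → ‖x' - z‖ < 2 * r →
    |g x t - g x' t| ≤ (m + 1) * ‖x - x'‖} with hN
  have hposJ : ∀ t, |t - τ| < 2 * r → 0 < t := fun t ht => by
    have := abs_lt.1 ht; linarith
  have hZc : IsClosed Z := by
    simp only [hZ, ofPred_forall]
    refine isClosed_iInter fun t => isClosed_iInter fun t' => isClosed_iInter fun h1 =>
      isClosed_iInter fun h2 => isClosed_le ?_ continuous_const
    have c1 := (hg.space t (hposJ t h1)).continuous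
    have c2 := (hg.space t' (hposJ t' h2)).continuous
    fun_prop
  have hKZN : ∀ x t, ‖x - z‖ < 2 * r → |t - τ| < 2 * r → (x, t) ∈ K → x ∈ Z ∧ t ∈ N := by
    intro x t hx ht hxt
    have hmem : (⟨(x, t), hxt⟩ : K) ∈ F m := by
      apply hball
      rw [mem_ball, Subtype.dist_eq, Prod.dist_eq, max_lt_iff]
      constructor
      · simp only [dist_eq_norm]; linarith
      · simp only [Real.dist_eq]; linarith
    refine ⟨fun s s' hs hs' => ?_, fun y y' hy hy' => ?_⟩
    · refine hmem.1 s s' (hposJ s hs) (hposJ s' hs') ?_ ?_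
      · simp only [Real.norm_eq_abs]
        rw [abs_lt] at *; constructor <;> linarith [hs.1, hs.2, ht.1, ht.2]
      · simp only [Real.norm_eq_abs]
        rw [abs_lt] at *; constructor <;> linarith [hs'.1, hs'.2, ht.1, ht.2]
    · refine hmem.2 y y' ?_ ?_
      · have := norm_sub_le_norm_sub_add_norm_sub y z x
        rw [norm_sub_rev z x] at this
        simp only; linarith
      · have := norm_sub_le_norm_sub_add_norm_sub y' z x
        rw [norm_sub_rev z x] at this
        simp only; linarith
  have hall : ∀ x t, ‖x - z‖ < r → |t - τ| < r → ContinuousAt G (x, t) := by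
    intro x t hx ht
    by_cases hxK : (x, t) ∈ K
    swap
    · exact hnK _ (hposJ t (by linarith)) hxK
    obtain ⟨hxZ, htN⟩ := hKZN x t (by linarith) (by linarith) hxK
    have ht' := abs_lt.1 ht
    have nx : ∀ y, ‖y - x‖ < r → ‖y - z‖ < 2 * r := fun y hy => by
      have := norm_sub_le_norm_sub_add_norm_sub y x z
      linarith
    have nt : ∀ s, |s - t| < r → |s - τ| < 2 * r := fun s hs => by
      have := abs_lt.1 hs
      rw [abs_lt]; constructor <;> linarith
    refine cross_cont hn ha hg (ρ := r) (m := m + 1) (Z := Z) (N := N) hr (by linarith)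
      (by positivity) hZc hxZ htN ?_ ?_ ?_
    · intro y hy _ s s' hs hs'
      exact hy s s' (nt s hs) (nt s' hs')
    · intro s hs _ y y' hy hy'
      exact hs y y' (nx y hy) (nx y' hy')
    · intro y s hy hs hcc
      refine hnK (y, s) (hposJ s (nt s hs)) fun hK => ?_
      have := hKZN y s (nx y hy) (nt s hs) hK
      tauto
  apply hp0.2
  change ∀ᶠ q in 𝓝 (z, τ), ContinuousAt G q
  rw [Metric.eventually_nhds_iff]
  refine ⟨r, hr, ?_⟩
  rintro ⟨x, t⟩ hxt
  rw [Prod.dist_eq, max_lt_iff] at hxt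
  exact hall x t (by simpa [dist_eq_norm] using hxt.1) (by simpa [Real.dist_eq] using hxt.2)

end LogHeat

namespace LogHeat
open Set Filter Topology Metric

lemma fderiv_coord {n : ℕ} (v : EuclideanSpace ℝ (Fin n) → ℝ) (y w : EuclideanSpace ℝ (Fin n)) :
    fderiv ℝ v y w = ∑ i, w i * pd v i y := by
  have h : w = ∑ i, w i • EuclideanSpace.single i (1 : ℝ) := by
    have := (EuclideanSpace.basisFun (Fin n) ℝ).sum_repr w
    simpa using this.symm
  conv_lhs => rw [h]
  simp [map_sum, pd]

/-- Infinitesimal form of the two point estimate. -/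
lemma pointwise {n : ℕ} {a ε R h T t0 s : ℝ} {g : EuclideanSpace ℝ (Fin n) → ℝ → ℝ}
    {A ζ : ℝ → ℝ} {y : EuclideanSpace ℝ (Fin n)} (hg : Sol n a g) (hs : 0 < s)
    (hA : ∀ t, HasDerivAt A (Real.exp (a * t) - ε) t) (hε : 0 < Real.exp (a * s) - ε)
    (hR : 0 < R) (hh : 0 < h) (ht0 : t0 < s) (hT : s < T)
    (hζ : ContinuousAt ζ s) (hζp : 0 < ζ s)
    (H : ∀ y' t x s, ‖y' - y‖ < R → t0 < t → t ≤ T → ‖x - y‖ ≤ 2 * R →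
      t - h ≤ s → s < t → 0 ≤ Phi g A ζ y R y' t x s) :
    (Real.exp (a * s) - ε) * ∑ i, (pd (fun x => g x s) i y) ^ 2 - (ζ s)⁻¹ ≤ deriv (g y) s := by
  set α := Real.exp (a * s) - ε with hα
  set w : EuclideanSpace ℝ (Fin n) := WithLp.toLp 2 (fun i => 2 * α * pd (fun x => g x s) i y)
    with hw
  set D := ∑ i, (pd (fun x => g x s) i y) ^ 2 with hD
  have hwi : ∀ i, w i = 2 * α * pd (fun x => g x s) i y := fun i => rfl
  have hwD : ‖w‖ ^ 2 = 4 * α ^ 2 * D := by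
    rw [EuclideanSpace.norm_sq_eq, hD, Finset.mul_sum]
    refine Finset.sum_congr rfl fun i _ => ?_
    rw [hwi, Real.norm_eq_abs, sq_abs]; ring
  have hdw : fderiv ℝ (fun x => g x s) y w = 2 * α * D := by
    rw [fderiv_coord, hD, Finset.mul_sum]
    refine Finset.sum_congr rfl fun i _ => ?_
    rw [hwi]; ring
  have l1 := (hg.hasDerivAt y hs).tendsto_slope_zero_right
  have l2 : Tendsto (fun τ : ℝ => τ⁻¹ • (g (y + τ • w) s - g y s)) (𝓝[>] 0) (𝓝 (2 * α * D)) := by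
    have hdiff := ((hg.space s hs).differentiable (by norm_num)) y
    have hl : HasDerivAt (fun τ : ℝ => y + τ • w) w 0 := by
      simpa using ((hasDerivAt_id (0:ℝ)).smul_const w).const_add y
    have hf : HasFDerivAt (fun x => g x s) (fderiv ℝ (fun x => g x s) y) (y + (0:ℝ) • w) := by
      simpa using hdiff.hasFDerivAt
    have := (hf.comp_hasDerivAt (0:ℝ) hl).tendsto_slope_zero_right
    rw [hdw] at this
    simpa using this
  have l3 := (hA s).tendsto_slope_zero_right
  have l4 : Tendsto (fun τ : ℝ => (ζ (s + τ))⁻¹) (𝓝[>] 0) (𝓝 (ζ s)⁻¹) := by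
    have hc : Tendsto (fun τ : ℝ => s + τ) (𝓝[>] 0) (𝓝 s) := by
      have : Tendsto (fun τ : ℝ => s + τ) (𝓝 0) (𝓝 (s + 0)) := by
        exact (continuous_const.add continuous_id).tendsto 0
      rw [add_zero] at this
      exact this.mono_left nhdsWithin_le_nhds
    exact (hζ.tendsto.comp hc).inv₀ hζp.ne'
  have l5 : Tendsto (fun τ : ℝ => ‖w‖ ^ 2 / (4 * (τ⁻¹ • (A (s + τ) - A s)))) (𝓝[>] 0)
      (𝓝 (‖w‖ ^ 2 / (4 * α))) :=
    (tendsto_const_nhds).div (l3.const_mul 4) (by positivity)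
  have lall := ((l1.sub l2).add l5).add l4
  have hge : 0 ≤ deriv (g y) s - 2 * α * D + ‖w‖ ^ 2 / (4 * α) + (ζ s)⁻¹ := by
    refine ge_of_tendsto lall ?_
    have c1 : ∀ᶠ τ : ℝ in 𝓝[>] 0, ‖(y + τ • w) - y‖ ≤ 2 * R := by
      have : ContinuousAt (fun τ : ℝ => ‖(y + τ • w) - y‖) 0 := by fun_prop
      have := this.eventually_lt_const (show ‖(y + (0:ℝ) • w) - y‖ < 2 * R by simpa using hR)
      exact (this.filter_mono nhdsWithin_le_nhds).mono fun _ h => h.le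
    filter_upwards [c1, Ioo_mem_nhdsGT hh, Ioo_mem_nhdsGT (show 0 < T - s by linarith)]
      with τ k1 k2 k3
    have hτ := k2.1
    have k := H y (s + τ) (y + τ • w) s (by simpa using hR) (by linarith) (by linarith [k3.2])
      k1 (by linarith [k2.2]) (by linarith)
    unfold Phi at k
    have e1 : ‖y - (y + τ • w)‖ ^ 2 = τ ^ 2 * ‖w‖ ^ 2 := by
      rw [sub_add_cancel_left, norm_neg, norm_smul, mul_pow, Real.norm_eq_abs, sq_abs]
    rw [e1] at k
    have k' := mul_nonneg (inv_pos.2 hτ).le k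
    refine k'.trans (le_of_eq ?_)
    simp only [smul_eq_mul, sub_self, norm_zero, add_sub_cancel_left]
    field_simp
    ring
  rw [hwD] at hge
  have : 4 * α ^ 2 * D / (4 * α) = α * D := by field_simp
  rw [this] at hge
  linarith

lemma AA0_pos {a : ℝ} (ha : a ≠ 0) {s t : ℝ} (h : s < t) : 0 < AA a 0 t - AA a 0 s := by
  obtain ⟨ξ, -, e⟩ := A_mvt (fun t => AA_deriv ha 0 t) h
  rw [e, sub_zero]
  exact mul_pos (Real.exp_pos _) (by linarith)

set_option maxHeartbeats 1000000 in
lemma approx {n : ℕ} {a : ℝ} {g : EuclideanSpace ℝ (Fin n) → ℝ → ℝ} (hn : 1 ≤ n) (ha : a ≠ 0)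
    (hg : Sol n a g) (y : EuclideanSpace ℝ (Fin n)) {s : ℝ} (hs : 0 < s) :
    ∃ m > 0, ∀ η, 0 < η → η ≤ 1 / 4 → η < s →
    (Real.exp (a * s) - η * m) * ∑ i, (pd (fun x => g x s) i y) ^ 2 -
      (2 / n * (1 - 2 * η) * (AA a 0 s - AA a 0 η))⁻¹ ≤ deriv (g y) s := by
  obtain ⟨m, M, hm, hM, hb⟩ := exp_bounds a 0 (s + 1)
  have hn0 : (0:ℝ) < n := by exact_mod_cast hn
  refine ⟨m / 4, by positivity, fun η hη0 hη1 hηs => ?_⟩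
  have hηm : 0 < η * m := by positivity
  set ε := η * (m / 4) with hε
  have hε0 : 0 < ε := by positivity
  have hεm : ε ≤ m / 2 := by rw [hε]; nlinarith
  set lam : ℝ := 2 / n * (1 - 2 * η) with hlam
  have hlam0 : 0 < lam := by
    have : 0 < 1 - 2 * η := by linarith
    positivity
  have hlamn : lam ≤ 2 / n := by
    have : 0 < 2 / (n:ℝ) := by positivity
    rw [hlam]; nlinarith
  -- uniform continuity
  have huc : UniformContinuousOn (fun ξ => Real.exp (a * ξ)) (Icc 0 (s + 1)) :=
    isCompact_Icc.uniformContinuousOn_of_continuous (by fun_prop)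
  obtain ⟨δ, hδ, huc⟩ := Metric.uniformContinuousOn_iff.1 huc ε hε0
  set h0 := min (δ / 2) (η / 2) with hh0
  have hh00 : 0 < h0 := by positivity
  have hh0δ : h0 < δ := by have : h0 ≤ δ / 2 := min_le_left _ _; linarith
  have hh0η : h0 ≤ η / 2 := min_le_right _ _
  set C1 : ℝ := 4 * n + 24 + 16 * M ^ 2 / ((2 * (m / 2) / n) * ε) with hC1
  have hC10 : 0 < C1 := by positivity
  have hζ : ∀ t, η < t → 0 < lam * (AA a 0 t - AA a 0 η) := fun t ht =>
    mul_pos hlam0 (AA0_pos ha ht)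
  set Q := C1 * (lam * (AA a 0 (s + 1) - AA a 0 η)) / (η * m / n) with hQ
  have hQ0 : 0 < Q := by
    have := hζ (s + 1) (by linarith)
    positivity
  have hζmono : ∀ t, t ≤ s + 1 → lam * (AA a 0 t - AA a 0 η) ≤
      lam * (AA a 0 (s + 1) - AA a 0 η) := by
    intro t ht
    rcases eq_or_lt_of_le ht with h | h
    · rw [h]
    · have := AA0_pos ha h
      gcongr; linarith
  have hAAc : Continuous (AA a 0) := by
    rw [continuous_iff_continuousAt]; exact fun t => (AA_deriv ha 0 t).continuousAt
  have hζc : Continuous (fun t => lam * (AA a 0 t - AA a 0 η)) := by fun_prop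
  obtain ⟨h, hh, -, H⟩ := local_est (n := n) (a := a) (ε := ε) (R := 1 + Q) (αm := m / 2)
    (σM := M) (μ := η) (t0 := η) (T := s + 1) (h0 := h0) (g := g) (A := AA a ε)
    (ζ := fun t => lam * (AA a 0 t - AA a 0 η)) (ζ' := fun t => lam * Real.exp (a * t))
    (x0 := y) hn hg (fun t => AA_deriv ha _ t) hε0 (by positivity) hh00 (by linarith)
    (by
      rintro ⟨x, t⟩ ⟨hx, ht⟩
      have ht1 : η - h0 ≤ t := ht.1
      exact (joint_cont hn ha hg x t (by linarith)).continuousWithinAt)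
    hM (fun ξ hξ => (hb ξ ⟨by linarith [hξ.1], hξ.2⟩).2) (by positivity)
    (fun ξ hξ => by
      have := (hb ξ ⟨by linarith [hξ.1], hξ.2⟩).1
      linarith) hη0 (by linarith) hζc.continuousOn (by simp) (fun t ht => hζ t ht.1)
    (fun t ht => by
      have := ((AA_deriv ha 0 t).sub_const (AA a 0 η)).const_mul lam
      simpa using this)
    (fun t ht => mul_nonneg hlam0.le (Real.exp_pos _).le)
    (by
      intro t ht ξ hξ
      rw [← hC1]
      have htm : t ∈ Icc 0 (s + 1) := ⟨by linarith [ht.1], ht.2⟩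
      have hξm : ξ ∈ Icc 0 (s + 1) := ⟨by linarith [ht.1, hξ.1], by linarith [hξ.2, ht.2]⟩
      have h1 := huc t htm ξ hξm (by
        rw [Real.dist_eq, abs_of_nonneg (by linarith [hξ.2])]; linarith [hξ.1])
      rw [Real.dist_eq, abs_lt] at h1
      have h2 := (hb t htm).1
      have h3 : C1 * (lam * (AA a 0 t - AA a 0 η)) / (1 + Q) ^ 2 ≤ η * m / n := by
        rw [div_le_iff₀ (by positivity)]
        calc C1 * (lam * (AA a 0 t - AA a 0 η))
            ≤ C1 * (lam * (AA a 0 (s + 1) - AA a 0 η)) := by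
              have := hζmono t ht.2
              gcongr
          _ = η * m / n * Q := by rw [hQ]; field_simp
          _ ≤ η * m / n * (1 + Q) ^ 2 := by gcongr; nlinarith
      refine (add_le_add_right h3 _).trans ?_
      have h4 : lam * Real.exp (a * t) + η * m / n =
        2 / n * ((1 - 2 * η) * Real.exp (a * t) + η * m / 2) := by rw [hlam]; ring
      have h5 : (1 - η) * (2 / n * (Real.exp (a * ξ) - ε)) =
        2 / n * ((1 - η) * (Real.exp (a * ξ) - ε)) := by ring
      rw [h4, h5]
      apply mul_le_mul_of_nonneg_left _ (by positivity)
      have h6 : (1 - η) * (Real.exp (a * t) - 2 * ε) ≤ (1 - η) * (Real.exp (a * ξ) - ε) := by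
        apply mul_le_mul_of_nonneg_left _ (by linarith); linarith [h1.2]
      have h7 : η * m ≤ η * Real.exp (a * t) := by gcongr
      have h8 : ε = η * m / 4 := by rw [hε]; ring
      rw [h8] at h6 ⊢
      nlinarith)
  have := pointwise (a := a) (ε := ε) (R := 1 + Q) (h := h) (T := s + 1) (t0 := η) (s := s)
    (y := y) hg hs (fun t => AA_deriv ha ε t)
    (by have := (hb s ⟨hs.le, by linarith⟩).1; linarith) (by positivity) hh hηs (by linarith)
    hζc.continuousAt (hζ s hηs) H
  exact this

lemma final_g {n : ℕ} {a : ℝ} {g : EuclideanSpace ℝ (Fin n) → ℝ → ℝ} (hn : 1 ≤ n) (ha : a ≠ 0)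
    (hg : Sol n a g) (y : EuclideanSpace ℝ (Fin n)) {s : ℝ} (hs : 0 < s) :
    -(2 / n * AA a 0 s)⁻¹ ≤ ∑ i, pdd (fun x => g x s) i y := by
  obtain ⟨m, hm, H⟩ := approx hn ha hg y hs
  have hn0 : (0:ℝ) < n := by exact_mod_cast hn
  have h00 : AA a 0 0 = 0 := by simp [AA]
  have hpos : 0 < AA a 0 s := by have := AA0_pos ha hs; rwa [h00, sub_zero] at this
  have hAAc : Continuous (AA a 0) := by
    rw [continuous_iff_continuousAt]; exact fun t => (AA_deriv ha 0 t).continuousAt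
  set D := ∑ i, (pd (fun x => g x s) i y) ^ 2 with hD
  have hc : ContinuousAt (fun η : ℝ => (Real.exp (a * s) - η * m) * D -
      (2 / n * (1 - 2 * η) * (AA a 0 s - AA a 0 η))⁻¹) 0 := by
    refine ContinuousAt.sub (by fun_prop) (ContinuousAt.inv₀ (by fun_prop) ?_)
    simp only [h00]
    have : 0 < 2 / (n:ℝ) * AA a 0 s := by positivity
    simpa using this.ne'
  have hl := hc.tendsto.mono_left (nhdsWithin_le_nhds (s := Ioi 0))
  have := le_of_tendsto hl (b := deriv (g y) s) (by
    filter_upwards [Ioo_mem_nhdsGT (show (0:ℝ) < 1 / 4 by norm_num), Ioo_mem_nhdsGT hs]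
      with η h1 h2
    exact H η h1.1 h1.2.le h2.2)
  rw [hg.eqn y s hs, ← hD] at this
  simp only [h00, mul_zero, zero_mul, sub_zero, mul_one] at this
  linarith

lemma sol_of_u {n : ℕ} {a : ℝ} {u : EuclideanSpace ℝ (Fin n) → ℝ → ℝ}
    (hpos : ∀ x t, 0 < t → 0 < u x t)
    (hspace : ∀ t, 0 < t → ContDiff ℝ 2 (fun x => u x t))
    (htime : ∀ x, ContDiffOn ℝ 1 (u x) (Set.Ioi 0))
    (heq : ∀ x t, 0 < t →
      deriv (u x) t = laplacian (fun y => u y t) x + a * u x t * Real.log (u x t)) :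
    Sol n a (fun x t => Real.exp (-a * t) * Real.log (u x t)) := by
  have hsp : ∀ t, 0 < t → ContDiff ℝ 2 (fun x => Real.exp (-a * t) * Real.log (u x t)) :=
    fun t ht => contDiff_const.mul ((hspace t ht).log fun x => (hpos x t ht).ne')
  refine ⟨hsp, fun x => ?_, fun x t ht => ?_⟩
  · refine ContDiffOn.mul (by fun_prop) ((htime x).log fun t ht => (hpos x t ht).ne')
  · have hu := hpos x t ht
    have hut : HasDerivAt (u x) (deriv (u x) t) t :=
      (((htime x).differentiableOn (by norm_num)).differentiableAt (Ioi_mem_nhds ht)).hasDerivAt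
    have he : HasDerivAt (fun t => Real.exp (-a * t)) (-a * Real.exp (-a * t)) t := by
      have := ((hasDerivAt_id t).const_mul (-a)).exp
      refine this.congr_deriv ?_
      simp [mul_comm]
    have hd : HasDerivAt (fun t => Real.exp (-a * t) * Real.log (u x t))
        (-a * Real.exp (-a * t) * Real.log (u x t) + Real.exp (-a * t) * (deriv (u x) t / u x t)) t :=
      he.mul (hut.log hu.ne')
    rw [hd.deriv, heq x t ht, laplacian_eq]
    set E := Real.exp (-a * t) with hE
    have hEE : Real.exp (a * t) * E = 1 := by
      rw [hE, ← Real.exp_add]; simp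
    have e1 : ∀ i, pd (fun y => E * Real.log (u y t)) i x = E * (u x t)⁻¹ *
        pd (fun y => u y t) i x := by
      intro i
      exact pd_comp (v := fun y => u y t) (f := fun r => E * Real.log r)
        ((hspace t ht).differentiable (by norm_num) x)
        ((Real.hasDerivAt_log hu.ne').const_mul E) i
    have e2 : ∀ i, pdd (fun y => E * Real.log (u y t)) i x = E * (u x t)⁻¹ *
        pdd (fun y => u y t) i x + E * (-(u x t ^ 2)⁻¹) * (pd (fun y => u y t) i x) ^ 2 := by
      intro i
      exact pdd_comp (v := fun y => u y t) (f := fun r => E * Real.log r)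
        (f' := fun r => E * r⁻¹) (hspace t ht)
        (fun y => (Real.hasDerivAt_log (hpos y t ht).ne').const_mul E)
        ((hasDerivAt_inv hu.ne').const_mul E) i
    simp only [e1, e2, mul_pow]
    rw [Finset.sum_add_distrib, ← Finset.mul_sum, ← Finset.mul_sum, ← Finset.mul_sum]
    have : Real.exp (a * t) * (E ^ 2 * (u x t)⁻¹ ^ 2 * ∑ i, pd (fun y => u y t) i x ^ 2) =
      (Real.exp (a * t) * E) * (E * (u x t)⁻¹ ^ 2 * ∑ i, pd (fun y => u y t) i x ^ 2) := by ring
    rw [this, hEE]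
    field_simp
    ring

lemma final_u {n : ℕ} (hn : 1 ≤ n) {a : ℝ} (ha : a ≠ 0) {u : EuclideanSpace ℝ (Fin n) → ℝ → ℝ}
    (hpos : ∀ x t, 0 < t → 0 < u x t)
    (hspace : ∀ t, 0 < t → ContDiff ℝ 2 (fun x => u x t))
    (htime : ∀ x, ContDiffOn ℝ 1 (u x) (Set.Ioi 0))
    (heq : ∀ x t, 0 < t →
      deriv (u x) t = laplacian (fun y => u y t) x + a * u x t * Real.log (u x t))
    (x : EuclideanSpace ℝ (Fin n)) {t : ℝ} (ht : 0 < t) :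
      0 ≤ laplacian (fun y => Real.log (u y t)) x
        + n * a / (2 * (1 - Real.exp (-a * t))) := by
  have h := final_g hn ha (sol_of_u hpos hspace htime heq) x ht
  have hn0 : (0:ℝ) < n := by exact_mod_cast hn
  set E := Real.exp (-a * t) with hE
  have hE0 : 0 < E := Real.exp_pos _
  have hexp : Real.exp (a * t) = E⁻¹ := by
    rw [hE, ← Real.exp_neg]; simp
  have hls : ContDiff ℝ 2 (fun y => Real.log (u y t)) :=
    (hspace t ht).log fun x => (hpos x t ht).ne'
  have e : ∀ i, pdd (fun y => E * Real.log (u y t)) i x =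
      E * pdd (fun y => Real.log (u y t)) i x := by
    intro i
    have := pdd_comp (v := fun y => Real.log (u y t)) (f := fun r => E * r) (f' := fun _ => E)
      (f'' := 0) (x := x) hls (fun y => by simpa using (hasDerivAt_id _).const_mul E)
      (hasDerivAt_const _ E) i
    rw [this]; ring
  simp only [e] at h
  rw [← Finset.mul_sum, ← laplacian_eq] at h
  have hE1 : 1 - E ≠ 0 := by
    rw [sub_ne_zero, ne_comm, hE, Ne, Real.exp_eq_one_iff]
    exact mul_ne_zero (neg_ne_zero.2 ha) ht.ne'
  have hval : (2 / n * AA a 0 t)⁻¹ = E * (n * a / (2 * (1 - E))) := by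
    rw [AA, hexp]
    have : E⁻¹ - 1 = (1 - E) / E := by field_simp
    rw [this]
    field_simp
    simpa using hE1
  rw [hval] at h
  have : 0 ≤ E * (laplacian (fun y => Real.log (u y t)) x + n * a / (2 * (1 - E))) := by linarith
  exact nonneg_of_mul_nonneg_right this hE0

end LogHeat

/-- Sharp differential Harnack inequality for positive solutions of the
logarithmic heat equation `∂ₜu = Δu + a u ln u` on `ℝⁿ × (0,∞)`:
`Δ (ln u(·,t)) + n a / (2 (1 - e^{-a t})) ≥ 0`. -/
theorem stmt_0 (n : ℕ) (hn : 1 ≤ n) (a : ℝ) (ha : a ≠ 0)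
    (u : EuclideanSpace ℝ (Fin n) → ℝ → ℝ)
    (hpos : ∀ x t, 0 < t → 0 < u x t)
    (hspace : ∀ t, 0 < t → ContDiff ℝ 2 (fun x => u x t))
    (htime : ∀ x, ContDiffOn ℝ 1 (u x) (Set.Ioi 0))
    (heq : ∀ x t, 0 < t →
      deriv (u x) t = laplacian (fun y => u y t) x + a * u x t * Real.log (u x t)) :
    ∀ x t, 0 < t →
      0 ≤ laplacian (fun y => Real.log (u y t)) x
        + n * a / (2 * (1 - Real.exp (-a * t))) := by
  exact fun x t ht => LogHeat.final_u hn ha hpos hspace htime heq x ht
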